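/- Let s ∈ 𝔛 with s_k > 0 for all k, and let R*_s be the Riesz measure on 𝒵 with Laplace transform Δ_{−s} on 𝒫. Then Θ(R*_s) = 𝒫, the domain of means M_{F(R*_s)} equals 𝒬, and the inverse ψ_s of the mean map of F(R*_s) is given by ψ_s(m) = −(log δ_{−s})′(m) for every m ∈ 𝒬 (the gradient taken with respect to the trace inner product on 𝒵). -/

import Mathlib

open Matrix MeasureTheory Finset
open scoped ENNReal

namespace Wishart

instance {m n α : Type*} [MeasurableSpace α] : MeasurableSpace (Matrix m n α) :=
  inferInstanceAs (MeasurableSpace (m → n → α))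

/-- Index set of an `N × N` matrix partitioned into `r + 1` blocks of sizes `n 0, …, n r`. -/
abbrev Idx (r : ℕ) (n : Fin (r + 1) → ℕ+) := Σ k : Fin (r + 1), Fin (n k)

/-- Real matrices over the partitioned index set. -/
abbrev Mat (r : ℕ) (n : Fin (r + 1) → ℕ+) := Matrix (Idx r n) (Idx r n) ℝ

variable {r : ℕ} {n : Fin (r + 1) → ℕ+}

/-- The `(l,k)` block of a partitioned matrix. -/
def blk (x : Mat r n) (l k : Fin (r + 1)) : Matrix (Fin (n l)) (Fin (n k)) ℝ :=
  Matrix.of fun a b => x ⟨l, a⟩ ⟨k, b⟩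

variable (V : ∀ l k : Fin (r + 1), Submodule ℝ (Matrix (Fin (n l)) (Fin (n k)) ℝ))

/-- Condition (V1): `A ∈ 𝒱_{lk}`, `B ∈ 𝒱_{ki}` implies `A B ∈ 𝒱_{li}` for `i < k < l`. -/
def CondV1 : Prop := ∀ i k l : Fin (r + 1), i < k → k < l →
  ∀ A ∈ V l k, ∀ B ∈ V k i, A * B ∈ V l i

/-- Condition (V2): `A ∈ 𝒱_{li}`, `B ∈ 𝒱_{ki}` implies `A Bᵀ ∈ 𝒱_{lk}` for `i < k < l`. -/
def CondV2 : Prop := ∀ i k l : Fin (r + 1), i < k → k < l →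
  ∀ A ∈ V l i, ∀ B ∈ V k i, A * Bᵀ ∈ V l k

/-- Condition (V3): `A ∈ 𝒱_{lk}` implies `A Aᵀ ∈ ℝ I`. -/
def CondV3 : Prop := ∀ k l : Fin (r + 1), k < l →
  ∀ A ∈ V l k, ∃ c : ℝ, A * Aᵀ = c • (1 : Matrix (Fin (n l)) (Fin (n l)) ℝ)

/-- The space `𝒵` of symmetric matrices with lower blocks in `𝒱_{lk}` and scalar diagonal
blocks. -/
def Zspace : Set (Mat r n) :=
  {x | x.IsSymm ∧ (∀ k l : Fin (r + 1), k < l → blk x l k ∈ V l k) ∧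
    ∀ k : Fin (r + 1), ∃ c : ℝ, ∀ a b : Fin (n k),
      x ⟨k, a⟩ ⟨k, b⟩ = if a = b then c else 0}

/-- The trace inner product `⟨x, y⟩ = tr (x y)`. -/
def tip (x y : Mat r n) : ℝ := (x * y).trace

/-- The homogeneous cone `𝒫 = 𝒵 ∩ Sym₊(N, ℝ)`. -/
def Pcone : Set (Mat r n) := {x | x ∈ Zspace V ∧ x.PosDef}

/-- The dual cone `𝒬 = {ξ ∈ 𝒵 : ⟨ξ, x⟩ > 0 for all nonzero x in the closure of 𝒫}`. -/
def Qcone : Set (Mat r n) :=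
  {ξ | ξ ∈ Zspace V ∧ ∀ x ∈ closure (Pcone V), x ≠ 0 → 0 < tip ξ x}

/-- The group `H` of block lower triangular matrices with strictly lower blocks in `𝒱_{lk}`
and positive scalar diagonal blocks. -/
def Hgrp : Set (Mat r n) :=
  {T | (∀ k l : Fin (r + 1), l < k → blk T l k = 0) ∧
    (∀ k l : Fin (r + 1), k < l → blk T l k ∈ V l k) ∧
    ∀ k : Fin (r + 1), ∃ t : ℝ, 0 < t ∧ ∀ a b : Fin (n k),
      T ⟨k, a⟩ ⟨k, b⟩ = if a = b then t else 0}

/-- `ρ(T) x = T x Tᵀ`. -/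
def rhoM (T x : Mat r n) : Mat r n := T * x * Tᵀ

/-- The diagonal scalar `t_{kk}` of a matrix with scalar diagonal blocks. -/
def tdiag (T : Mat r n) (k : Fin (r + 1)) : ℝ :=
  T ⟨k, ⟨0, (n k).2⟩⟩ ⟨k, ⟨0, (n k).2⟩⟩

/-- The one-dimensional representation `χ_s(T) = ∏_k t_{kk}^{2 s_k}`. -/
noncomputable def chi (s : Fin (r + 1) → ℝ) (T : Mat r n) : ℝ :=
  ∏ k : Fin (r + 1), tdiag T k ^ (2 * s k)

/-- `½ Σ_{i<k} ε_i dim 𝒱_{ki}`. -/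
noncomputable def xiBound (ε : Fin (r + 1) → Bool) (k : Fin (r + 1)) : ℝ :=
  (1 / 2) * ∑ i ∈ Finset.univ.filter (fun i => i < k),
    (if ε i then (Module.finrank ℝ (V k i) : ℝ) else 0)

/-- The Gindikin set `Ξ`. -/
def XiSet : Set (Fin (r + 1) → ℝ) :=
  ⋃ ε : Fin (r + 1) → Bool,
    {s | ∀ k, (ε k = true → xiBound V ε k < s k) ∧ (ε k = false → s k = xiBound V ε k)}

/-- `½ Σ_{l>k} ε_l dim 𝒱_{lk}`. -/
noncomputable def frakBound (ε : Fin (r + 1) → Bool) (k : Fin (r + 1)) : ℝ :=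
  (1 / 2) * ∑ l ∈ Finset.univ.filter (fun l => k < l),
    (if ε l then (Module.finrank ℝ (V l k) : ℝ) else 0)

/-- The Gindikin set `𝔛`. -/
def frakX : Set (Fin (r + 1) → ℝ) :=
  ⋃ ε : Fin (r + 1) → Bool,
    {s | ∀ k, (ε k = true → frakBound V ε k < s k) ∧ (ε k = false → s k = frakBound V ε k)}

/-- Laplace transform `L_μ(θ) = ∫ e^{-⟨θ,x⟩} dμ(x)` (with values in `[0,∞]`). -/
noncomputable def laplace (μ : Measure (Mat r n)) (θ : Mat r n) : ℝ≥0∞ :=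
  ∫⁻ x, ENNReal.ofReal (Real.exp (-(tip θ x))) ∂μ

/-- Real-valued Laplace transform. -/
noncomputable def laplaceR (μ : Measure (Mat r n)) (θ : Mat r n) : ℝ :=
  ∫ x, Real.exp (-(tip θ x)) ∂μ

/-- Mean of the natural-exponential-family member `P(θ,μ)`, computed entrywise:
`m_μ(θ) = L_μ(θ)⁻¹ ∫ x e^{-⟨θ,x⟩} dμ(x)`. -/
noncomputable def meanMap (μ : Measure (Mat r n)) (θ : Mat r n) : Mat r n :=
  Matrix.of fun p q => (laplaceR μ θ)⁻¹ * ∫ x, Real.exp (-(tip θ x)) * x p q ∂μ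

/-- Covariance operator of `P(θ,μ)` with mean `m`, applied to `ξ ∈ 𝒵` (entrywise):
`V ξ = ∫ ⟨ξ, x - m⟩ (x - m) dP(θ,μ)(x)`. -/
noncomputable def varOp (μ : Measure (Mat r n)) (θ m ξ : Mat r n) : Mat r n :=
  Matrix.of fun p q =>
    (laplaceR μ θ)⁻¹ * ∫ x, Real.exp (-(tip θ x)) * tip ξ (x - m) * ((x - m) p q) ∂μ

/-- Leading principal submatrix `y_{{1:k}}` consisting of the blocks with indices `≤ k`. -/
def lead (k : Fin (r + 1)) (y : Mat r n) :
    Matrix {p : Idx r n // p.1 ≤ k} {p : Idx r n // p.1 ≤ k} ℝ :=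
  Matrix.of fun p q => y p.1 q.1

/-- Zero-padding `z₀` of a matrix `z` defined on the blocks with indices `≤ k`. -/
def pad (k : Fin (r + 1)) (z : Matrix {p : Idx r n // p.1 ≤ k} {p : Idx r n // p.1 ≤ k} ℝ) :
    Mat r n :=
  Matrix.of fun p q => if h : p.1 ≤ k ∧ q.1 ≤ k then z ⟨p, h.1⟩ ⟨q, h.2⟩ else 0

/-- `J_k = (I_{N_k})₀`. -/
def Jmat (k : Fin (r + 1)) : Mat r n := pad k 1

/-- Parameters of elements of `W_i`: the scalar `x_{ii}` and the blocks `X_{li}`. -/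
abbrev Wparam (r : ℕ) (n : Fin (r + 1) → ℕ+) (i : Fin (r + 1)) :=
  ℝ × ∀ l : Fin (r + 1), Matrix (Fin (n l)) (Fin (n i)) ℝ

/-- The `N × n_i` matrix in `W_i` with `i`-th block row `x_{ii} I` and `l`-th block row
`X_{li}` for `l > i`. -/
def toW (i : Fin (r + 1)) (p : Wparam r n i) : Matrix (Idx r n) (Fin (n i)) ℝ :=
  Matrix.of fun q b =>
    if q.1 = i then (if (q.2 : ℕ) = (b : ℕ) then p.1 else 0)
    else if i < q.1 then p.2 q.1 q.2 b else 0

/-- A parameter tuple gives an honest element of `W_i`: blocks lie in `𝒱_{li}` and vanish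
for `l ≤ i`. -/
def WGood (i : Fin (r + 1)) (p : Wparam r n i) : Prop :=
  (∀ l : Fin (r + 1), i < l → p.2 l ∈ V l i) ∧ (∀ l : Fin (r + 1), ¬ i < l → p.2 l = 0)

/-- The inner product `(A|B)` on `𝒱_{lk}`, characterized by `(ABᵀ + BAᵀ)/2 = (A|B) I`. -/
noncomputable def bip (l : Fin (r + 1)) {k : Fin (r + 1)}
    (A B : Matrix (Fin (n l)) (Fin (n k)) ℝ) : ℝ :=
  (A * Bᵀ).trace / (n l : ℝ)

open scoped Classical in
/-- The generalized power function `Δ_s` on `𝒫`, defined by `Δ_s(ρ(T) I) = χ_s(T)`. -/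
noncomputable def DeltaDef (s : Fin (r + 1) → ℝ) (x : Mat r n) : ℝ :=
  if h : ∃ T, T ∈ Hgrp V ∧ x = rhoM T 1 then chi s h.choose else 0

/-- Index set for the block diagonal matrix `Φ(ξ) = diag(φ_0(ξ), …, φ_r(ξ))`,
where `φ_i(ξ)` is of size `m_i = mdc i + 1`. -/
abbrev DIdx (r : ℕ) (mdc : Fin (r + 1) → ℕ) := Σ i : Fin (r + 1), Fin (mdc i + 1)

/-- The block diagonal matrix `Φ(ξ) = diag(φ_0(ξ), …, φ_r(ξ))`. -/
def PhiMat {mdc : Fin (r + 1) → ℕ}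
    (φ : ∀ i : Fin (r + 1), Mat r n → Matrix (Fin (mdc i + 1)) (Fin (mdc i + 1)) ℝ)
    (ξ : Mat r n) : Matrix (DIdx r mdc) (DIdx r mdc) ℝ :=
  Matrix.of fun p q =>
    if h : p.1 = q.1 then φ p.1 ξ p.2 (Fin.cast (by rw [h]) q.2) else 0

/-- `Φ(I_N)^{-1/2}`: the inverse square root of the (diagonal, positive) matrix `Φ(I_N)`. -/
noncomputable def PhiISqrtInv {mdc : Fin (r + 1) → ℕ}
    (φ : ∀ i : Fin (r + 1), Mat r n → Matrix (Fin (mdc i + 1)) (Fin (mdc i + 1)) ℝ) :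
    Matrix (DIdx r mdc) (DIdx r mdc) ℝ :=
  Matrix.diagonal fun p => (PhiMat φ (1 : Mat r n) p p) ^ (-(1 / 2) : ℝ)

section Blocks

theorem blk_add (x y : Mat r n) (l k : Fin (r + 1)) :
    blk (x + y) l k = blk x l k + blk y l k := rfl

theorem blk_smul (c : ℝ) (x : Mat r n) (l k : Fin (r + 1)) :
    blk (c • x) l k = c • blk x l k := rfl

theorem blk_zero (l k : Fin (r + 1)) : blk (0 : Mat r n) l k = 0 := rfl

theorem blk_transpose (x : Mat r n) (l k : Fin (r + 1)) : blk xᵀ l k = (blk x k l)ᵀ := rfl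

theorem blk_one_diag (k : Fin (r + 1)) : blk (1 : Mat r n) k k = 1 := by
  ext a b
  simp [blk, Matrix.one_apply]

theorem blk_one_ne {l k : Fin (r + 1)} (h : l ≠ k) : blk (1 : Mat r n) l k = 0 := by
  ext a b
  simp [blk, h]

theorem blk_mul (x y : Mat r n) (l k : Fin (r + 1)) :
    blk (x * y) l k = ∑ i, blk x l i * blk y i k := by
  ext a b
  simp [blk, Matrix.mul_apply, Fintype.sum_sigma, Matrix.sum_apply]

theorem exists_diag_iff (x : Mat r n) (k : Fin (r + 1)) :
    (∃ c : ℝ, ∀ a b : Fin (n k), x ⟨k, a⟩ ⟨k, b⟩ = if a = b then c else 0) ↔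
      ∃ c : ℝ, blk x k k = c • 1 := by
  refine exists_congr fun c => ⟨fun h => ?_, fun h a b => ?_⟩
  · ext a b
    simp [blk, h, Matrix.one_apply]
  · have := congrFun (congrFun h a) b
    simpa [blk, Matrix.one_apply] using this

theorem tdiag_of_blk {x : Mat r n} {k : Fin (r + 1)} {c : ℝ} (h : blk x k k = c • 1) :
    tdiag x k = c := by
  have := congrFun (congrFun h ⟨0, (n k).2⟩) ⟨0, (n k).2⟩
  simpa [blk, tdiag] using this

theorem tdiag_add (x y : Mat r n) (k : Fin (r + 1)) :
    tdiag (x + y) k = tdiag x k + tdiag y k := rfl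

theorem tdiag_smul (c : ℝ) (x : Mat r n) (k : Fin (r + 1)) :
    tdiag (c • x) k = c * tdiag x k := rfl

theorem tdiag_transpose (x : Mat r n) (k : Fin (r + 1)) : tdiag xᵀ k = tdiag x k := rfl

theorem tdiag_one (k : Fin (r + 1)) : tdiag (1 : Mat r n) k = 1 := by
  simp [tdiag]

theorem continuous_tdiag (k : Fin (r + 1)) : Continuous fun x : Mat r n => tdiag x k :=
  continuous_id.matrix_elem _ _

/-- The algebra of block lower triangular matrices containing the group `H`. -/
def lowSub : Submodule ℝ (Mat r n) where
  carrier := {T | (∀ k l : Fin (r + 1), l < k → blk T l k = 0) ∧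
    (∀ k l : Fin (r + 1), k < l → blk T l k ∈ V l k) ∧ ∀ k, ∃ c : ℝ, blk T k k = c • 1}
  zero_mem' := ⟨fun _ _ _ => rfl, fun _ _ _ => by rw [blk_zero]; exact zero_mem _,
    fun _ => ⟨0, by simp [blk_zero]⟩⟩
  add_mem' := by
    rintro x y ⟨h1, h2, h3⟩ ⟨g1, g2, g3⟩
    refine ⟨fun k l h => ?_, fun k l h => ?_, fun k => ?_⟩
    · rw [blk_add, h1 k l h, g1 k l h, add_zero]
    · rw [blk_add]
      exact add_mem (h2 k l h) (g2 k l h)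
    · obtain ⟨c, hc⟩ := h3 k
      obtain ⟨d, hd⟩ := g3 k
      exact ⟨c + d, by rw [blk_add, hc, hd, add_smul]⟩
  smul_mem' := by
    rintro c x ⟨h1, h2, h3⟩
    refine ⟨fun k l h => ?_, fun k l h => ?_, fun k => ?_⟩
    · rw [blk_smul, h1 k l h, smul_zero]
    · rw [blk_smul]
      exact Submodule.smul_mem _ _ (h2 k l h)
    · obtain ⟨d, hd⟩ := h3 k
      exact ⟨c * d, by rw [blk_smul, hd, smul_smul]⟩

/-- The space `𝒵` as a submodule. -/
def zSub : Submodule ℝ (Mat r n) where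
  carrier := Zspace V
  zero_mem' := ⟨Matrix.isSymm_zero, fun _ _ _ => by rw [blk_zero]; exact zero_mem _,
    fun _ => ⟨0, by simp⟩⟩
  add_mem' := by
    rintro x y ⟨h1, h2, h3⟩ ⟨g1, g2, g3⟩
    refine ⟨h1.add g1, fun k l h => ?_, fun k => ?_⟩
    · rw [blk_add]
      exact add_mem (h2 k l h) (g2 k l h)
    · obtain ⟨c, hc⟩ := (exists_diag_iff x k).1 (h3 k)
      obtain ⟨d, hd⟩ := (exists_diag_iff y k).1 (g3 k)
      exact (exists_diag_iff _ k).2 ⟨c + d, by rw [blk_add, hc, hd, add_smul]⟩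
  smul_mem' := by
    rintro c x ⟨h1, h2, h3⟩
    refine ⟨h1.smul c, fun k l h => ?_, fun k => ?_⟩
    · rw [blk_smul]
      exact Submodule.smul_mem _ _ (h2 k l h)
    · obtain ⟨d, hd⟩ := (exists_diag_iff x k).1 (h3 k)
      exact (exists_diag_iff _ k).2 ⟨c * d, by rw [blk_smul, hd, smul_smul]⟩

variable {V}

theorem mem_zSub {x : Mat r n} : x ∈ zSub V ↔ x ∈ Zspace V := Iff.rfl

theorem blk_diag_of_mem_lowSub {T : Mat r n} (hT : T ∈ lowSub V) (k : Fin (r + 1)) :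
    blk T k k = tdiag T k • 1 := by
  obtain ⟨c, hc⟩ := hT.2.2 k
  rw [tdiag_of_blk hc, hc]

theorem blk_diag_of_mem_Zspace {x : Mat r n} (hx : x ∈ Zspace V) (k : Fin (r + 1)) :
    blk x k k = tdiag x k • 1 := by
  obtain ⟨c, hc⟩ := (exists_diag_iff x k).1 (hx.2.2 k)
  rw [tdiag_of_blk hc, hc]

theorem mem_Hgrp_iff {T : Mat r n} : T ∈ Hgrp V ↔ T ∈ lowSub V ∧ ∀ k, 0 < tdiag T k := by
  constructor
  · rintro ⟨h1, h2, h3⟩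
    refine ⟨⟨h1, h2, fun k => (exists_diag_iff T k).1 ?_⟩, fun k => ?_⟩
    · obtain ⟨t, -, ht⟩ := h3 k
      exact ⟨t, ht⟩
    · obtain ⟨t, h0, ht⟩ := h3 k
      simpa [tdiag, ht] using h0
  · rintro ⟨⟨h1, h2, h3⟩, h4⟩
    refine ⟨h1, h2, fun k => ?_⟩
    obtain ⟨t, ht⟩ := (exists_diag_iff T k).2 (h3 k)
    exact ⟨t, by simpa [tdiag, ht] using h4 k, ht⟩

theorem one_mem_lowSub : (1 : Mat r n) ∈ lowSub V :=
  ⟨fun _ _ h => blk_one_ne h.ne, fun _ _ h => by rw [blk_one_ne h.ne']; exact zero_mem _,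
    fun k => ⟨1, by rw [blk_one_diag, one_smul]⟩⟩

theorem one_mem_Zspace : (1 : Mat r n) ∈ Zspace V :=
  ⟨Matrix.isSymm_one, fun _ _ h => by rw [blk_one_ne h.ne']; exact zero_mem _,
    fun k => (exists_diag_iff _ k).2 ⟨1, by rw [blk_one_diag, one_smul]⟩⟩

theorem one_mem_Hgrp : (1 : Mat r n) ∈ Hgrp V :=
  mem_Hgrp_iff.2 ⟨one_mem_lowSub, fun k => by simp [tdiag_one]⟩

theorem blk_mul_diag {A B : Mat r n} (hA : A ∈ lowSub V) (hB : B ∈ lowSub V)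
    (k : Fin (r + 1)) : blk (A * B) k k = (tdiag A k * tdiag B k) • 1 := by
  rw [blk_mul, Finset.sum_eq_single k]
  · rw [blk_diag_of_mem_lowSub hA, blk_diag_of_mem_lowSub hB]
    simp [smul_smul, mul_comm]
  · intro i _ hi
    rcases lt_or_gt_of_ne hi with h | h
    · rw [hB.1 _ _ h, Matrix.mul_zero]
    · rw [hA.1 _ _ h, Matrix.zero_mul]
  · simp

theorem tdiag_mul {A B : Mat r n} (hA : A ∈ lowSub V) (hB : B ∈ lowSub V) (k : Fin (r + 1)) :
    tdiag (A * B) k = tdiag A k * tdiag B k :=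
  tdiag_of_blk (blk_mul_diag hA hB k)

theorem mul_mem_lowSub (hV1 : CondV1 V) {A B : Mat r n} (hA : A ∈ lowSub V)
    (hB : B ∈ lowSub V) : A * B ∈ lowSub V := by
  refine ⟨fun k l h => ?_, fun k l h => ?_, fun k => ⟨_, blk_mul_diag hA hB k⟩⟩
  · rw [blk_mul]
    refine Finset.sum_eq_zero fun i _ => ?_
    rcases lt_or_ge l i with hi | hi
    · rw [hA.1 _ _ hi, Matrix.zero_mul]
    · rw [hB.1 _ _ (hi.trans_lt h), Matrix.mul_zero]
  · rw [blk_mul]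
    refine Submodule.sum_mem _ fun i _ => ?_
    rcases lt_trichotomy i k with hi | rfl | hi
    · rw [hB.1 _ _ hi, Matrix.mul_zero]
      exact zero_mem _
    · rw [blk_diag_of_mem_lowSub hB]
      simpa using Submodule.smul_mem _ _ (hA.2.1 _ _ h)
    · rcases lt_trichotomy i l with hl | rfl | hl
      · exact hV1 k i l hi hl _ (hA.2.1 _ _ hl) _ (hB.2.1 _ _ hi)
      · rw [blk_diag_of_mem_lowSub hA]
        simpa using Submodule.smul_mem _ _ (hB.2.1 _ _ h)
      · rw [hA.1 _ _ hl, Matrix.zero_mul]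
        exact zero_mem _

theorem mul_mem_Hgrp (hV1 : CondV1 V) {A B : Mat r n} (hA : A ∈ Hgrp V) (hB : B ∈ Hgrp V) :
    A * B ∈ Hgrp V := by
  rw [mem_Hgrp_iff] at *
  refine ⟨mul_mem_lowSub hV1 hA.1 hB.1, fun k => ?_⟩
  rw [tdiag_mul hA.1 hB.1]
  exact mul_pos (hA.2 k) (hB.2 k)

theorem mul_transpose_self_mem_Zspace (hV2 : CondV2 V) (hV3 : CondV3 V) {A : Mat r n}
    (hA : A ∈ lowSub V) : A * Aᵀ ∈ Zspace V := by
  refine ⟨Matrix.isSymm_mul_transpose_self A, fun k l h => ?_,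
    fun k => (exists_diag_iff _ k).2 ?_⟩
  · rw [blk_mul]
    refine Submodule.sum_mem _ fun i _ => ?_
    rw [blk_transpose]
    rcases lt_trichotomy i k with hi | rfl | hi
    · exact hV2 i k l hi h _ (hA.2.1 _ _ (hi.trans h)) _ (hA.2.1 _ _ hi)
    · rw [blk_diag_of_mem_lowSub hA]
      simpa using Submodule.smul_mem _ _ (hA.2.1 _ _ h)
    · rw [hA.1 _ _ hi]
      simp
  · suffices blk (A * Aᵀ) k k ∈ Submodule.span ℝ {(1 : Matrix (Fin (n k)) (Fin (n k)) ℝ)} by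
      obtain ⟨c, hc⟩ := Submodule.mem_span_singleton.1 this
      exact ⟨c, hc.symm⟩
    rw [blk_mul]
    refine Submodule.sum_mem _ fun i _ => ?_
    rw [blk_transpose, Submodule.mem_span_singleton]
    rcases lt_trichotomy i k with hi | rfl | hi
    · obtain ⟨c, hc⟩ := hV3 i k hi _ (hA.2.1 _ _ hi)
      exact ⟨c, hc.symm⟩
    · exact ⟨tdiag A i * tdiag A i, by
        rw [blk_diag_of_mem_lowSub hA]; simp [smul_smul]⟩
    · exact ⟨0, by rw [hA.1 _ _ hi]; simp⟩

theorem mul_transpose_add_mem_Zspace (hV2 : CondV2 V) (hV3 : CondV3 V) {A B : Mat r n}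
    (hA : A ∈ lowSub V) (hB : B ∈ lowSub V) : A * Bᵀ + B * Aᵀ ∈ Zspace V := by
  have h := sub_mem (sub_mem
    (mem_zSub.2 (mul_transpose_self_mem_Zspace hV2 hV3 (add_mem hA hB)))
    (mem_zSub.2 (mul_transpose_self_mem_Zspace hV2 hV3 hA)))
    (mem_zSub.2 (mul_transpose_self_mem_Zspace hV2 hV3 hB))
  convert mem_zSub.1 h using 1
  rw [Matrix.transpose_add]
  noncomm_ring

theorem add_transpose_mem_Zspace (hV2 : CondV2 V) (hV3 : CondV3 V) {U : Mat r n}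
    (hU : U ∈ lowSub V) : U + Uᵀ ∈ Zspace V := by
  simpa using mul_transpose_add_mem_Zspace hV2 hV3 hU one_mem_lowSub

/-- Every element of `𝒵` is the symmetrization of an element of the triangular algebra. -/
theorem exists_lowSub_add_transpose {x : Mat r n} (hx : x ∈ Zspace V) :
    ∃ U ∈ lowSub V, x = U + Uᵀ := by
  let U : Mat r n := Matrix.of fun p q =>
    if q.1 < p.1 then x p q else if p.1 = q.1 then x p q / 2 else 0
  have hsymm : ∀ p q, x p q = x q p := fun p q => hx.1.apply q p
  refine ⟨U, ⟨fun k l h => ?_, fun k l h => ?_, fun k => ⟨tdiag x k / 2, ?_⟩⟩, ?_⟩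
  · ext a b
    simp [blk, U, h.not_gt, h.ne]
  · convert hx.2.1 k l h using 1
    ext a b
    simp [blk, U, h]
  · have := blk_diag_of_mem_Zspace hx k
    ext a b
    have h2 := congrFun (congrFun this a) b
    simp only [blk, Matrix.of_apply, Matrix.smul_apply, smul_eq_mul] at h2
    simp [blk, U, h2]
    ring
  · ext p q
    simp only [U, Matrix.add_apply, Matrix.transpose_apply, Matrix.of_apply]
    rcases lt_trichotomy p.1 q.1 with h | h | h
    · simp [h, h.not_gt, h.ne, hsymm p q]
    · simp [h, hsymm q p]
    · simp [h, h.not_gt, h.ne]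

theorem conj_mem_Zspace (hV1 : CondV1 V) (hV2 : CondV2 V) (hV3 : CondV3 V) {T x : Mat r n}
    (hT : T ∈ lowSub V) (hx : x ∈ Zspace V) : T * x * Tᵀ ∈ Zspace V := by
  obtain ⟨U, hU, rfl⟩ := exists_lowSub_add_transpose hx
  convert mul_transpose_add_mem_Zspace hV2 hV3 (mul_mem_lowSub hV1 hT hU) hT using 1
  rw [Matrix.transpose_mul]
  noncomm_ring

/-- Elements of `H` act injectively on column vectors. -/
theorem eq_zero_of_mulVec_eq_zero {T : Mat r n} (hT : T ∈ Hgrp V) {v : Idx r n → ℝ}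
    (h : T *ᵥ v = 0) : v = 0 := by
  obtain ⟨hl, hp⟩ := mem_Hgrp_iff.1 hT
  have key : ∀ k : Fin (r + 1), ∀ a : Fin (n k), v ⟨k, a⟩ = 0 := by
    intro k
    induction k using WellFoundedLT.induction with
    | ind k ih =>
      intro a
      have h1 := congrFun h ⟨k, a⟩
      rw [Matrix.mulVec, dotProduct, Fintype.sum_sigma, Finset.sum_eq_single k] at h1
      · rw [Finset.sum_eq_single a] at h1
        · have h2 : T ⟨k, a⟩ ⟨k, a⟩ = tdiag T k := by
            have := congrFun (congrFun (blk_diag_of_mem_lowSub hl k) a) a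
            simpa [blk] using this
          rw [h2] at h1
          exact (mul_eq_zero.1 h1).resolve_left (hp k).ne'
        · intro b _ hb
          have := congrFun (congrFun (blk_diag_of_mem_lowSub hl k) a) b
          simp only [blk, Matrix.of_apply, Matrix.smul_apply, Matrix.one_apply_ne hb.symm,
            smul_zero] at this
          rw [this, zero_mul]
        · simp
      · intro i _ hi
        refine Finset.sum_eq_zero fun b _ => ?_
        rcases lt_or_gt_of_ne hi with h' | h'
        · rw [ih i h' b, mul_zero]
        · have := congrFun (congrFun (hl.1 i k h') a) b
          simp only [blk, Matrix.of_apply] at this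
          rw [this]
          simp
      · simp
  ext ⟨k, a⟩
  exact key k a

theorem isUnit_det_of_mem_Hgrp {T : Mat r n} (hT : T ∈ Hgrp V) : IsUnit T.det := by
  rw [isUnit_iff_ne_zero]
  intro h0
  obtain ⟨v, hv, h⟩ := Matrix.exists_mulVec_eq_zero_iff.2 h0
  exact hv (eq_zero_of_mulVec_eq_zero hT h)

/-- The group `H` is closed under inversion. -/
theorem inv_mem_Hgrp (hV1 : CondV1 V) {T : Mat r n} (hT : T ∈ Hgrp V) : T⁻¹ ∈ Hgrp V := by
  obtain ⟨hl, hp⟩ := mem_Hgrp_iff.1 hT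
  have hu := isUnit_det_of_mem_Hgrp hT
  let f : lowSub V →ₗ[ℝ] lowSub V :=
    (LinearMap.mulLeft ℝ T).restrict fun x hx => mul_mem_lowSub hV1 hl hx
  have hf : Function.Injective f := by
    rintro ⟨x, hx⟩ ⟨y, hy⟩ hxy
    have h1 : T * x = T * y := congrArg Subtype.val hxy
    have h2 := congrArg (T⁻¹ * ·) h1
    simp only [Matrix.nonsing_inv_mul_cancel_left _ _ hu] at h2
    exact Subtype.ext h2
  obtain ⟨⟨S, hS⟩, hS1⟩ := LinearMap.surjective_of_injective hf ⟨1, one_mem_lowSub⟩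
  have h1 : T * S = 1 := congrArg Subtype.val hS1
  have h2 : T⁻¹ = S := Matrix.inv_eq_right_inv h1
  rw [h2, mem_Hgrp_iff]
  refine ⟨hS, fun k => ?_⟩
  have h3 := tdiag_mul hl hS k
  rw [h1, tdiag_one] at h3
  exact pos_of_mul_pos_right (h3 ▸ one_pos) (hp k).le

theorem mul_transpose_self_mem_Pcone (hV2 : CondV2 V) (hV3 : CondV3 V) {T : Mat r n}
    (hT : T ∈ Hgrp V) : T * Tᵀ ∈ Pcone V := by
  refine ⟨mul_transpose_self_mem_Zspace hV2 hV3 (mem_Hgrp_iff.1 hT).1, ?_⟩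
  have := Matrix.PosDef.mul_conjTranspose_self T
    (Matrix.vecMul_injective_of_isUnit ((Matrix.isUnit_iff_isUnit_det _).2
      (isUnit_det_of_mem_Hgrp hT)))
  simpa [Matrix.conjTranspose_eq_transpose_of_trivial] using this

theorem trace_eq_sum_tdiag {x : Mat r n} (h : ∀ k, blk x k k = tdiag x k • 1) :
    x.trace = ∑ k, (n k : ℝ) * tdiag x k := by
  rw [Matrix.trace, Fintype.sum_sigma]
  refine Finset.sum_congr rfl fun k _ => ?_
  have : ∀ a : Fin (n k), x.diag ⟨k, a⟩ = tdiag x k := fun a => by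
    have := congrFun (congrFun (h k) a) a
    simpa [blk] using this
  rw [Finset.sum_congr rfl fun a _ => this a]
  simp

end Blocks

section Pairing

theorem tip_eq_sum (x y : Mat r n) : tip x y = ∑ p, ∑ q, x p q * y q p := by
  simp [tip, Matrix.trace, Matrix.mul_apply]

theorem tip_comm (x y : Mat r n) : tip x y = tip y x := Matrix.trace_mul_comm x y

theorem tip_add_left (x y z : Mat r n) : tip (x + y) z = tip x z + tip y z := by
  simp [tip, Matrix.add_mul]

theorem tip_add_right (x y z : Mat r n) : tip x (y + z) = tip x y + tip x z := by
  simp [tip, Matrix.mul_add]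

theorem tip_sub_left (x y z : Mat r n) : tip (x - y) z = tip x z - tip y z := by
  simp [tip, Matrix.sub_mul]

theorem tip_sub_right (x y z : Mat r n) : tip x (y - z) = tip x y - tip x z := by
  simp [tip, Matrix.mul_sub]

theorem tip_smul_left (c : ℝ) (x y : Mat r n) : tip (c • x) y = c * tip x y := by
  simp [tip]

theorem tip_smul_right (c : ℝ) (x y : Mat r n) : tip x (c • y) = c * tip x y := by
  simp [tip]

theorem tip_conj (m T x : Mat r n) : tip m (T * x * Tᵀ) = tip (Tᵀ * m * T) x := by
  simp only [tip]
  rw [Matrix.mul_assoc (Tᵀ * m), Matrix.mul_assoc Tᵀ, Matrix.trace_mul_comm Tᵀ,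
    ← Matrix.mul_assoc, ← Matrix.mul_assoc]

theorem continuous_tip {X : Type*} [TopologicalSpace X] {f g : X → Mat r n}
    (hf : Continuous f) (hg : Continuous g) : Continuous fun t => tip (f t) (g t) :=
  (hf.matrix_mul hg).matrix_trace

theorem tip_one_left (x : Mat r n) : tip 1 x = x.trace := by simp [tip]

/-- The squared Frobenius norm. -/
def nsq (T : Mat r n) : ℝ := (T * Tᵀ).trace

theorem nsq_eq_sum (T : Mat r n) : nsq T = ∑ p, ∑ q, T p q ^ 2 := by
  simp [nsq, Matrix.trace, Matrix.mul_apply, sq]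

theorem nsq_nonneg (T : Mat r n) : 0 ≤ nsq T := by
  rw [nsq_eq_sum]
  positivity

theorem nsq_eq_zero_iff (T : Mat r n) : nsq T = 0 ↔ T = 0 := by
  have := Matrix.trace_mul_conjTranspose_self_eq_zero_iff (A := T)
  simpa [nsq, Matrix.conjTranspose_eq_transpose_of_trivial] using this

theorem sq_entry_le_nsq (T : Mat r n) (p q : Idx r n) : T p q ^ 2 ≤ nsq T := by
  rw [nsq_eq_sum]
  refine le_trans ?_ (Finset.single_le_sum (f := fun p => ∑ q, T p q ^ 2)
    (fun i _ => Finset.sum_nonneg fun j _ => sq_nonneg _) (Finset.mem_univ p))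
  exact Finset.single_le_sum (f := fun q => T p q ^ 2) (fun i _ => sq_nonneg _)
    (Finset.mem_univ q)

theorem nsq_smul (c : ℝ) (T : Mat r n) : nsq (c • T) = c ^ 2 * nsq T := by
  simp [nsq, sq, mul_assoc]

theorem continuous_nsq : Continuous (nsq : Mat r n → ℝ) :=
  (continuous_id.matrix_mul continuous_id.matrix_transpose).matrix_trace

theorem abs_entry_le {T : Mat r n} {R : ℝ} (hR : 0 ≤ R) (h : nsq T ≤ R ^ 2) (p q : Idx r n) :
    T p q ∈ Set.Icc (-R) R := by
  have := abs_le_of_sq_le_sq ((sq_entry_le_nsq T p q).trans h) hR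
  exact abs_le.1 this

/-- If `x, y ∈ 𝒵` pair equally with all of `𝒵`, they agree. -/
theorem eq_of_tip_eq {V} {x y : Mat r n} (hx : x ∈ Zspace V) (hy : y ∈ Zspace V)
    (h : ∀ z ∈ Zspace V, tip x z = tip y z) : x = y := by
  have hd : x - y ∈ Zspace V := mem_zSub.1 (sub_mem (mem_zSub.2 hx) (mem_zSub.2 hy))
  have h0 : nsq (x - y) = 0 := by
    have h1 : nsq (x - y) = tip (x - y) (x - y) := by
      rw [nsq, tip, hd.1.eq]
    rw [h1, tip_sub_left, h _ hd, sub_self]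
  exact sub_eq_zero.1 ((nsq_eq_zero_iff _).1 h0)

theorem isCompact_box (R : ℝ) :
    IsCompact {T : Mat r n | ∀ p q, T p q ∈ Set.Icc (-R) R} := by
  have h := isCompact_univ_pi fun _ : Idx r n => isCompact_univ_pi fun _ : Idx r n =>
    isCompact_Icc (a := -R) (b := R)
  have h2 : {T : Mat r n | ∀ p q, T p q ∈ Set.Icc (-R) R} =
      Set.univ.pi fun _ => Set.univ.pi fun _ => Set.Icc (-R) R := by
    ext T
    exact ⟨fun hT p _ q _ => hT p q, fun hT p q => hT p trivial q trivial⟩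
  rw [h2]
  exact h

variable {V}

theorem isClosed_lowSub : IsClosed (lowSub V : Set (Mat r n)) :=
  Submodule.closed_of_finiteDimensional _

theorem isClosed_Zspace : IsClosed (Zspace V) :=
  Submodule.closed_of_finiteDimensional (zSub V)

/-- A continuous function, homogeneous of degree two and positive away from the origin of a
closed subspace, dominates a multiple of the squared norm. -/
theorem exists_mul_nsq_le {q : Mat r n → ℝ} (hq : Continuous q)
    (hq2 : ∀ (c : ℝ) (T : Mat r n), q (c • T) = c ^ 2 * q T)
    (hpos : ∀ T ∈ lowSub V, T ≠ 0 → 0 < q T) :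
    ∃ c > 0, ∀ T ∈ lowSub V, c * nsq T ≤ q T := by
  let K : Set (Mat r n) := {T | ∀ p q, T p q ∈ Set.Icc (-1 : ℝ) 1} ∩
    ((lowSub V : Set (Mat r n)) ∩ {T | nsq T = 1})
  have hK : IsCompact K := (isCompact_box 1).inter_right
    (isClosed_lowSub.inter (isClosed_eq continuous_nsq continuous_const))
  have hsph : ∀ T ∈ lowSub V, T ≠ 0 → (√(nsq T))⁻¹ • T ∈ K ∧ 0 < nsq T := by
    intro T hT h0
    have hp : 0 < nsq T := lt_of_le_of_ne (nsq_nonneg T) fun h =>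
      h0 ((nsq_eq_zero_iff T).1 h.symm)
    have h1 : nsq ((√(nsq T))⁻¹ • T) = 1 := by
      rw [nsq_smul, inv_pow, Real.sq_sqrt hp.le, inv_mul_cancel₀ hp.ne']
    exact ⟨⟨abs_entry_le zero_le_one (by rw [h1]; norm_num),
      Submodule.smul_mem _ _ hT, h1⟩, hp⟩
  obtain ⟨T0, hT0, hmin⟩ := hK.exists_isMinOn
    ⟨_, (hsph 1 one_mem_lowSub (by
      have : Nonempty (Idx r n) := ⟨⟨0, ⟨0, (n 0).2⟩⟩⟩
      exact one_ne_zero)).1⟩ hq.continuousOn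
  refine ⟨q T0, hpos T0 hT0.2.1 ?_, fun T hT => ?_⟩
  · rintro rfl
    have : nsq (0 : Mat r n) = 1 := hT0.2.2
    simp [(nsq_eq_zero_iff (0 : Mat r n)).2 rfl] at this
  · by_cases h0 : T = 0
    · subst h0
      have := hq2 0 (0 : Mat r n)
      simp only [smul_zero] at this
      rw [this, (nsq_eq_zero_iff (0 : Mat r n)).2 rfl]
      simp
    · obtain ⟨h1, h2⟩ := hsph T hT h0
      have h3 := isMinOn_iff.1 hmin _ h1
      rw [hq2, inv_pow, Real.sq_sqrt h2.le, inv_mul_eq_div, le_div_iff₀ h2] at h3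
      exact h3

end Pairing

section Optimization

variable {V}

/-- The logarithm of `χ_c` on the group `H`. -/
noncomputable def logChi (c : Fin (r + 1) → ℝ) (T : Mat r n) : ℝ :=
  ∑ k, 2 * c k * Real.log (tdiag T k)

theorem chi_eq_exp_logChi (c : Fin (r + 1) → ℝ) {T : Mat r n} (hT : ∀ k, 0 < tdiag T k) :
    chi c T = Real.exp (logChi c T) := by
  rw [chi, logChi, Real.exp_sum]
  refine Finset.prod_congr rfl fun k _ => ?_
  rw [Real.rpow_def_of_pos (hT k), mul_comm]

theorem chi_pos (c : Fin (r + 1) → ℝ) {T : Mat r n} (hT : T ∈ Hgrp V) : 0 < chi c T :=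
  Finset.prod_pos fun k _ => Real.rpow_pos_of_pos ((mem_Hgrp_iff.1 hT).2 k) _

theorem log_chi (c : Fin (r + 1) → ℝ) {T : Mat r n} (hT : T ∈ Hgrp V) :
    Real.log (chi c T) = logChi c T := by
  rw [chi_eq_exp_logChi c (mem_Hgrp_iff.1 hT).2, Real.log_exp]

theorem logChi_neg (c : Fin (r + 1) → ℝ) (T : Mat r n) : logChi (-c) T = -logChi c T := by
  simp [logChi]

theorem continuous_chi {c : Fin (r + 1) → ℝ} (hc : ∀ k, 0 < c k) :
    Continuous fun T : Mat r n => chi c T :=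
  continuous_finsetProd _ fun k _ => (continuous_tdiag k).rpow_const
    fun _ => Or.inr (by have := hc k; positivity)

/-- The closure of `H` inside the triangular algebra. -/
def hCl (V : ∀ l k : Fin (r + 1), Submodule ℝ (Matrix (Fin (n l)) (Fin (n k)) ℝ)) :
    Set (Mat r n) := (lowSub V : Set (Mat r n)) ∩ {T | ∀ k, 0 ≤ tdiag T k}

theorem isClosed_hCl : IsClosed (hCl V) := by
  refine isClosed_lowSub.inter ?_
  simp only [Set.ofPred_forall]
  exact isClosed_iInter fun k => isClosed_le continuous_const (continuous_tdiag k)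

theorem Hgrp_subset_hCl : Hgrp V ⊆ hCl V := fun _ hT =>
  ⟨(mem_Hgrp_iff.1 hT).1, fun k => ((mem_Hgrp_iff.1 hT).2 k).le⟩

theorem mem_Hgrp_of_chi_pos {c : Fin (r + 1) → ℝ} (hc : ∀ k, 0 < c k) {T : Mat r n}
    (hT : T ∈ hCl V) (h : 0 < chi c T) : T ∈ Hgrp V := by
  refine mem_Hgrp_iff.2 ⟨hT.1, fun k => lt_of_le_of_ne (hT.2 k) fun h0 => h.ne' ?_⟩
  refine Finset.prod_eq_zero (Finset.mem_univ k) ?_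
  rw [← h0, Real.zero_rpow (mul_pos two_pos (hc k)).ne']

theorem chi_le_nsq_rpow {c : Fin (r + 1) → ℝ} (hc : ∀ k, 0 < c k) {T : Mat r n}
    (hT : T ∈ hCl V) : chi c T ≤ nsq T ^ ∑ k, c k := by
  rw [chi, Real.rpow_sum_of_nonneg (nsq_nonneg T) fun k _ => (hc k).le]
  refine Finset.prod_le_prod (fun k _ => Real.rpow_nonneg (hT.2 k) _) fun k _ => ?_
  rw [Real.rpow_mul (hT.2 k)]
  refine Real.rpow_le_rpow (Real.rpow_nonneg (hT.2 k) _) ?_ (hc k).le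
  rw [Real.rpow_two]
  exact sq_entry_le_nsq T _ _

/-- Existence of maximizers of `log χ_c - q` on `H` for coercive `q`. -/
theorem exists_maximizer {c : Fin (r + 1) → ℝ} (hc : ∀ k, 0 < c k) {q : Mat r n → ℝ}
    (hq : Continuous q) {κ : ℝ} (hκ : 0 < κ) (hqκ : ∀ T ∈ lowSub V, κ * nsq T ≤ q T) :
    ∃ T ∈ Hgrp V, ∀ S ∈ Hgrp V, logChi c S - q S ≤ logChi c T - q T := by
  let f : Mat r n → ℝ := fun T => chi c T * Real.exp (-q T)
  have hf : Continuous f := (continuous_chi hc).mul (Real.continuous_exp.comp hq.neg)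
  have hfH : ∀ S ∈ Hgrp V, f S = Real.exp (logChi c S - q S) := fun S hS => by
    simp only [f]
    rw [chi_eq_exp_logChi c (mem_Hgrp_iff.1 hS).2, ← Real.exp_add, sub_eq_add_neg]
  have hf1 : 0 < f 1 := mul_pos (chi_pos c (V := V) one_mem_Hgrp) (Real.exp_pos _)
  have hlim := tendsto_rpow_mul_exp_neg_mul_atTop_nhds_zero (∑ k, c k) κ hκ
  obtain ⟨R0, hR0⟩ := Filter.eventually_atTop.1 (hlim.eventually (gt_mem_nhds hf1))
  set R := max 1 R0 with hR
  have hout : ∀ S ∈ Hgrp V, R ≤ nsq S → f S < f 1 := by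
    intro S hS hRS
    refine lt_of_le_of_lt ?_ (hR0 (nsq S) ((le_max_right _ _).trans hRS))
    refine mul_le_mul (chi_le_nsq_rpow hc (Hgrp_subset_hCl hS)) ?_ (Real.exp_pos _).le
      (Real.rpow_nonneg (nsq_nonneg S) _)
    exact Real.exp_le_exp.2 (by linarith [hqκ S (mem_Hgrp_iff.1 hS).1])
  have hR1 : 1 ≤ R := le_max_left _ _
  let K : Set (Mat r n) := {T | ∀ p q, T p q ∈ Set.Icc (-R) R} ∩ hCl V
  have hK : IsCompact K := (isCompact_box R).inter_right isClosed_hCl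
  have h1K : (1 : Mat r n) ∈ K := by
    refine ⟨fun p q => ?_, Hgrp_subset_hCl one_mem_Hgrp⟩
    rw [Matrix.one_apply]
    split_ifs <;> constructor <;> linarith
  obtain ⟨T, hTK, hmax⟩ := hK.exists_isMaxOn ⟨1, h1K⟩ hf.continuousOn
  have hTmax := isMaxOn_iff.1 hmax
  have hTH : T ∈ Hgrp V := by
    refine mem_Hgrp_of_chi_pos hc hTK.2 ?_
    exact pos_of_mul_pos_left (hf1.trans_le (hTmax 1 h1K)) (Real.exp_pos _).le
  refine ⟨T, hTH, fun S hS => ?_⟩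
  rw [← Real.exp_le_exp, ← hfH S hS, ← hfH T hTH]
  by_cases hS' : R ≤ nsq S
  · exact (hout S hS hS').le.trans (hTmax 1 h1K)
  · refine hTmax S ⟨abs_entry_le (by linarith) ?_, Hgrp_subset_hCl hS⟩
    nlinarith

theorem eventually_add_smul_mem_Hgrp {T W : Mat r n} (hT : T ∈ Hgrp V) (hW : W ∈ lowSub V) :
    ∀ᶠ e : ℝ in nhds 0, T + e • W ∈ Hgrp V := by
  obtain ⟨hl, hp⟩ := mem_Hgrp_iff.1 hT
  have h : ∀ k, ∀ᶠ e : ℝ in nhds 0, 0 < tdiag (T + e • W) k := fun k => by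
    have hc : Continuous fun e : ℝ => tdiag (T + e • W) k :=
      (continuous_tdiag k).comp (by fun_prop)
    refine hc.tendsto 0 |>.eventually (lt_mem_nhds ?_)
    simpa using hp k
  filter_upwards [Filter.eventually_all.2 h] with e he
  exact mem_Hgrp_iff.2 ⟨add_mem hl (Submodule.smul_mem _ _ hW), he⟩

theorem hasDerivAt_logChi (c : Fin (r + 1) → ℝ) {T : Mat r n} (hT : T ∈ Hgrp V)
    (W : Mat r n) :
    HasDerivAt (fun e : ℝ => logChi c (T + e • W))
      (∑ k, 2 * c k * (tdiag W k / tdiag T k)) 0 := by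
  refine HasDerivAt.fun_sum fun k _ => HasDerivAt.const_mul _ ?_
  have h1 : HasDerivAt (fun e : ℝ => tdiag (T + e • W) k) (tdiag W k) 0 := by
    simp only [tdiag_add, tdiag_smul]
    simpa using ((hasDerivAt_id (0 : ℝ)).mul_const (tdiag W k)).const_add (tdiag T k)
  have h2 := h1.log (by simpa using ((mem_Hgrp_iff.1 hT).2 k).ne')
  simpa using h2

theorem hasDerivAt_tip_quadratic (m T W : Mat r n) :
    HasDerivAt (fun e : ℝ => tip m ((T + e • W) * (T + e • W)ᵀ))
      (tip m (W * Tᵀ + T * Wᵀ)) 0 := by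
  have h : (fun e : ℝ => tip m ((T + e • W) * (T + e • W)ᵀ)) = fun e : ℝ =>
      tip m (T * Tᵀ) + e * tip m (W * Tᵀ + T * Wᵀ) + e ^ 2 * tip m (W * Wᵀ) := by
    funext e
    rw [← tip_smul_right, ← tip_smul_right, ← tip_add_right, ← tip_add_right]
    congr 1
    simp only [Matrix.transpose_add, Matrix.transpose_smul, Matrix.add_mul, Matrix.mul_add,
      Matrix.smul_mul, Matrix.mul_smul, smul_add, smul_smul, sq]
    abel
  rw [h]
  have h1 := ((hasDerivAt_id (0 : ℝ)).mul_const (tip m (W * Tᵀ + T * Wᵀ))).const_add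
    (tip m (T * Tᵀ))
  have h2 := ((hasDerivAt_id (0 : ℝ)).pow 2).mul_const (tip m (W * Wᵀ))
  simpa using h1.fun_add h2

/-- First order condition at a maximizer of `log χ_c - q`. -/
theorem deriv_eq_of_maximizer {c : Fin (r + 1) → ℝ} {q : Mat r n → ℝ} {T : Mat r n}
    (hT : T ∈ Hgrp V) (hmax : ∀ S ∈ Hgrp V, logChi c S - q S ≤ logChi c T - q T)
    {W : Mat r n} (hW : W ∈ lowSub V) {q' : ℝ}
    (hq' : HasDerivAt (fun e : ℝ => q (T + e • W)) q' 0) :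
    q' = ∑ k, 2 * c k * (tdiag W k / tdiag T k) := by
  have h1 := (hasDerivAt_logChi c hT W).sub hq'
  have h2 : IsLocalMax (fun e : ℝ => logChi c (T + e • W) - q (T + e • W)) 0 := by
    filter_upwards [eventually_add_smul_mem_Hgrp hT hW] with e he
    simpa using hmax _ he
  have := h2.hasDerivAt_eq_zero h1
  linarith

/-- The stationarity equation characterizing the mean at `T Tᵀ`. -/
def Stationary (V : ∀ l k : Fin (r + 1), Submodule ℝ (Matrix (Fin (n l)) (Fin (n k)) ℝ))
    (c : Fin (r + 1) → ℝ) (m T : Mat r n) : Prop :=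
  ∀ U ∈ lowSub V, tip m (T * (U + Uᵀ) * Tᵀ) = 2 * ∑ k, c k * tdiag U k

theorem stationary_of_forall_tangent (hV1 : CondV1 V) {c : Fin (r + 1) → ℝ} {m T : Mat r n}
    (hT : T ∈ Hgrp V) (h : ∀ W ∈ lowSub V,
      tip m (W * Tᵀ + T * Wᵀ) = ∑ k, 2 * c k * (tdiag W k / tdiag T k)) :
    Stationary V c m T := by
  intro U hU
  obtain ⟨hl, hp⟩ := mem_Hgrp_iff.1 hT
  have h2 : T * (U + Uᵀ) * Tᵀ = T * U * Tᵀ + T * (T * U)ᵀ := by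
    rw [Matrix.transpose_mul]
    noncomm_ring
  rw [h2, h _ (mul_mem_lowSub hV1 hl hU), Finset.mul_sum]
  refine Finset.sum_congr rfl fun k _ => ?_
  rw [tdiag_mul hl hU, mul_div_cancel_left₀ _ (hp k).ne']
  ring

theorem stationary_of_maximizer (hV1 : CondV1 V) {c : Fin (r + 1) → ℝ} {m T : Mat r n}
    (hT : T ∈ Hgrp V) (hmax : ∀ S ∈ Hgrp V,
      logChi c S - tip m (S * Sᵀ) ≤ logChi c T - tip m (T * Tᵀ)) :
    Stationary V c m T :=
  stationary_of_forall_tangent hV1 hT fun W hW =>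
    deriv_eq_of_maximizer (q := fun S => tip m (S * Sᵀ)) hT hmax hW
      (hasDerivAt_tip_quadratic m T W)

/-- Conjugation by any element of `H` maps `𝒵` onto itself. -/
theorem exists_eq_conj (hV1 : CondV1 V) (hV2 : CondV2 V) (hV3 : CondV3 V) {T x : Mat r n}
    (hT : T ∈ Hgrp V) (hx : x ∈ Zspace V) :
    T⁻¹ * x * T⁻¹ᵀ ∈ Zspace V ∧ T * (T⁻¹ * x * T⁻¹ᵀ) * Tᵀ = x := by
  refine ⟨conj_mem_Zspace hV1 hV2 hV3 (mem_Hgrp_iff.1 (inv_mem_Hgrp hV1 hT)).1 hx, ?_⟩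
  have hu := isUnit_det_of_mem_Hgrp hT
  have h2 : T⁻¹ᵀ * Tᵀ = 1 := by
    rw [← Matrix.transpose_mul, Matrix.mul_nonsing_inv _ hu, Matrix.transpose_one]
  calc T * (T⁻¹ * x * T⁻¹ᵀ) * Tᵀ = (T * T⁻¹) * x * (T⁻¹ᵀ * Tᵀ) := by noncomm_ring
    _ = x := by rw [h2, Matrix.mul_nonsing_inv _ hu]; simp

theorem Stationary.unique (hV1 : CondV1 V) (hV2 : CondV2 V) (hV3 : CondV3 V)
    {c : Fin (r + 1) → ℝ} {m m' T : Mat r n} (hT : T ∈ Hgrp V) (hm : m ∈ Zspace V)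
    (hm' : m' ∈ Zspace V) (h : Stationary V c m T) (h' : Stationary V c m' T) : m = m' := by
  refine eq_of_tip_eq hm hm' fun z hz => ?_
  obtain ⟨h1, h2⟩ := exists_eq_conj hV1 hV2 hV3 hT hz
  obtain ⟨U, hU, hU2⟩ := exists_lowSub_add_transpose h1
  rw [← h2, hU2, h U hU, h' U hU]

theorem trace_conj_pos {θ : Mat r n} (hθ : θ.PosDef) {S : Mat r n} (hS : S ≠ 0) :
    0 < (S * θ * Sᵀ).trace := by
  have hps : (S * θ * Sᵀ).PosSemidef := by
    simpa [Matrix.conjTranspose_eq_transpose_of_trivial] using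
      hθ.posSemidef.mul_mul_conjTranspose_same S
  refine lt_of_le_of_ne hps.trace_nonneg fun h => hS ?_
  have h0 := hps.trace_eq_zero_iff.1 h.symm
  ext p q
  by_contra hne
  have hv : S p ≠ 0 := fun hv => hne (by rw [hv]; rfl)
  have h1 := hθ.dotProduct_mulVec_pos hv
  have h2 := congrFun (congrFun h0 p) p
  rw [Matrix.mul_assoc, Matrix.mul_apply] at h2
  simp only [star_trivial, dotProduct, Matrix.mulVec, Matrix.mul_apply,
    Matrix.transpose_apply, Matrix.zero_apply] at h1 h2
  exact h1.ne' h2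

/-- Cholesky factorization: `H` acts transitively on `𝒫`. -/
theorem exists_Hgrp_of_mem_Pcone (hV1 : CondV1 V) (hV2 : CondV2 V) (hV3 : CondV3 V)
    {θ : Mat r n} (hθ : θ ∈ Pcone V) : ∃ T ∈ Hgrp V, θ = T * Tᵀ := by
  let q : Mat r n → ℝ := fun S => (S * θ * Sᵀ).trace
  have hq : Continuous q := by
    exact ((continuous_id.matrix_mul continuous_const).matrix_mul
      continuous_id.matrix_transpose).matrix_trace
  obtain ⟨κ, hκ, hqκ⟩ := exists_mul_nsq_le (V := V) hq
    (fun c T => by simp [q, sq, mul_assoc]) (fun T _ h0 => trace_conj_pos hθ.2 h0)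
  obtain ⟨S, hS, hmax⟩ := exists_maximizer (V := V) (c := fun k => (n k : ℝ))
    (fun k => by exact_mod_cast (n k).2) hq hκ hqκ
  obtain ⟨hl, hp⟩ := mem_Hgrp_iff.1 hS
  have hqt : ∀ A, q A = tip θ (Aᵀ * A) := fun A => by
    simp only [q, tip]
    rw [Matrix.mul_assoc, Matrix.trace_mul_comm, Matrix.mul_assoc]
  have hθS : S * θ * Sᵀ = 1 := by
    refine eq_of_tip_eq (conj_mem_Zspace hV1 hV2 hV3 hl hθ.1) one_mem_Zspace fun z hz => ?_
    obtain ⟨U, hU, rfl⟩ := exists_lowSub_add_transpose hz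
    have hd : HasDerivAt (fun e : ℝ => q (S + e • (U * S)))
        (tip θ ((U * S)ᵀ * S + Sᵀ * (U * S))) 0 := by
      have := hasDerivAt_tip_quadratic θ Sᵀ (U * S)ᵀ
      simpa [hqt] using this
    have h := deriv_eq_of_maximizer hS hmax (mul_mem_lowSub hV1 hU hl) hd
    have h2 : tip (S * θ * Sᵀ) (U + Uᵀ) = tip θ ((U * S)ᵀ * S + Sᵀ * (U * S)) := by
      have := tip_conj θ Sᵀ (U + Uᵀ)
      rw [Matrix.transpose_transpose] at this
      rw [← this, Matrix.transpose_mul]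
      congr 1
      noncomm_ring
    rw [h2, h, tip_one_left, Matrix.trace_add, Matrix.trace_transpose,
      trace_eq_sum_tdiag (blk_diag_of_mem_lowSub hU), ← Finset.sum_add_distrib]
    refine Finset.sum_congr rfl fun k _ => ?_
    rw [tdiag_mul hU hl, mul_div_cancel_right₀ _ (hp k).ne']
    ring
  refine ⟨S⁻¹, inv_mem_Hgrp hV1 hS, ?_⟩
  have hu := isUnit_det_of_mem_Hgrp hS
  have h2 : Sᵀ * S⁻¹ᵀ = 1 := by
    rw [← Matrix.transpose_mul, Matrix.nonsing_inv_mul _ hu, Matrix.transpose_one]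
  calc θ = (S⁻¹ * S) * θ * (Sᵀ * S⁻¹ᵀ) := by
        rw [h2, Matrix.nonsing_inv_mul _ hu]; simp
    _ = S⁻¹ * (S * θ * Sᵀ) * S⁻¹ᵀ := by noncomm_ring
    _ = S⁻¹ * S⁻¹ᵀ := by rw [hθS]; simp

end Optimization

section Topology

variable {V}

theorem eventually_posDef {X : Type*} [TopologicalSpace X] {f : X → Mat r n}
    (hf : Continuous f) (hs : ∀ x, (f x).IsSymm) {x₀ : X} (h₀ : (f x₀).PosDef) :
    ∀ᶠ x in nhds x₀, (f x).PosDef := by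
  let K : Set (Idx r n → ℝ) := (Set.univ.pi fun _ => Set.Icc (-1 : ℝ) 1) ∩ {v | v ⬝ᵥ v = 1}
  have hK : IsCompact K := (isCompact_univ_pi fun _ => isCompact_Icc).inter_right
    (isClosed_eq (continuous_id.dotProduct continuous_id) continuous_const)
  have hc : Continuous fun z : X × (Idx r n → ℝ) => z.2 ⬝ᵥ (f z.1 *ᵥ z.2) :=
    continuous_snd.dotProduct ((hf.comp continuous_fst).matrix_mulVec continuous_snd)
  have h1 : ∀ᶠ x in nhds x₀, ∀ v ∈ K, 0 < v ⬝ᵥ (f x *ᵥ v) := by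
    refine hK.eventually_forall_of_forall_eventually fun v hv => ?_
    refine (hc.tendsto (x₀, v)).eventually (lt_mem_nhds ?_)
    have hv0 : v ≠ 0 := by
      rintro rfl
      have : (0 : Idx r n → ℝ) ⬝ᵥ 0 = 1 := hv.2
      simp at this
    simpa using h₀.dotProduct_mulVec_pos hv0
  filter_upwards [h1] with x hx
  refine Matrix.PosDef.of_dotProduct_mulVec_pos ?_ fun v hv => ?_
  · rw [Matrix.IsHermitian, Matrix.conjTranspose_eq_transpose_of_trivial]
    exact hs x
  · have hp : 0 < v ⬝ᵥ v := by
      have := Matrix.dotProduct_star_self_pos_iff.2 hv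
      simpa using this
    have hsq : √(v ⬝ᵥ v) * √(v ⬝ᵥ v) = v ⬝ᵥ v := Real.mul_self_sqrt hp.le
    have hsp : 0 < √(v ⬝ᵥ v) := Real.sqrt_pos.2 hp
    have hw1 : ((√(v ⬝ᵥ v))⁻¹ • v) ⬝ᵥ ((√(v ⬝ᵥ v))⁻¹ • v) = 1 := by
      rw [smul_dotProduct, dotProduct_smul, smul_smul, ← mul_inv, hsq, smul_eq_mul,
        inv_mul_cancel₀ hp.ne']
    have hw : (√(v ⬝ᵥ v))⁻¹ • v ∈ K := by
      refine ⟨fun i _ => ?_, hw1⟩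
      have h2 : ((√(v ⬝ᵥ v))⁻¹ • v) i * ((√(v ⬝ᵥ v))⁻¹ • v) i ≤ 1 := by
        rw [← hw1]
        exact Finset.single_le_sum
          (f := fun i => ((√(v ⬝ᵥ v))⁻¹ • v) i * ((√(v ⬝ᵥ v))⁻¹ • v) i)
          (fun j _ => mul_self_nonneg _) (Finset.mem_univ i)
      exact ⟨by nlinarith, by nlinarith⟩
    have h3 := hx _ hw
    rw [Matrix.mulVec_smul, smul_dotProduct, dotProduct_smul, smul_smul] at h3
    have h4 : 0 < v ⬝ᵥ (f x *ᵥ v) := pos_of_mul_pos_right h3 (by positivity)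
    simpa using h4

/-- The orthogonal projection onto `𝒵` for the trace pairing. -/
theorem exists_projection (V : ∀ l k : Fin (r + 1), Submodule ℝ (Matrix (Fin (n l)) (Fin (n k)) ℝ)) :
    ∃ π : Mat r n → Mat r n, Continuous π ∧ ∀ y, π y ∈ Zspace V ∧
      ∀ z ∈ Zspace V, tip (π y) z = tip y z := by
  let g : Mat r n →ₗ[ℝ] Module.Dual ℝ (zSub V) :=
    LinearMap.mk₂ ℝ (fun (y : Mat r n) (z : zSub V) => tip y z)
      (fun x y z => tip_add_left x y z) (fun c x y => tip_smul_left c x y)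
      (fun x y z => tip_add_right x y z) (fun c x y => tip_smul_right c x y)
  let f : zSub V →ₗ[ℝ] Module.Dual ℝ (zSub V) := g ∘ₗ (zSub V).subtype
  have hf : Function.Injective f := fun x y hxy => Subtype.ext <|
    eq_of_tip_eq x.2 y.2 fun z hz => LinearMap.congr_fun hxy ⟨z, hz⟩
  let e := LinearEquiv.ofInjectiveOfFinrankEq f hf (Subspace.dual_finrank_eq).symm
  let π : Mat r n →ₗ[ℝ] Mat r n := (zSub V).subtype ∘ₗ e.symm.toLinearMap ∘ₗ g
  refine ⟨π, π.continuous_of_finiteDimensional, fun y => ⟨(e.symm (g y)).2, fun z hz => ?_⟩⟩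
  have h := e.apply_symm_apply (g y)
  exact LinearMap.congr_fun h ⟨z, hz⟩

end Topology

section Laplace

variable {V}

theorem measurable_entry (p q : Idx r n) : Measurable fun x : Mat r n => x p q :=
  (measurable_pi_apply q).comp (measurable_pi_apply (X := fun _ : Idx r n => Idx r n → ℝ) p)

theorem measurable_tip (θ : Mat r n) : Measurable fun x : Mat r n => tip θ x := by
  simp only [tip_eq_sum]
  exact Finset.measurable_sum _ fun p _ => Finset.measurable_sum _ fun q _ =>
    (measurable_entry q p).const_mul _

theorem measurable_exp_tip (θ : Mat r n) :
    Measurable fun x : Mat r n => Real.exp (-(tip θ x)) :=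
  (measurable_tip θ).neg.exp

variable {μ : Measure (Mat r n)}

theorem integrable_exp_of_laplace_lt_top {θ : Mat r n} (h : laplace μ θ < ⊤) :
    Integrable (fun x => Real.exp (-(tip θ x))) μ := by
  refine ⟨(measurable_exp_tip θ).aestronglyMeasurable, ?_⟩
  rw [hasFiniteIntegral_iff_ofReal (Filter.Eventually.of_forall fun x => (Real.exp_pos _).le)]
  exact h

theorem laplaceR_eq_toReal (θ : Mat r n) : laplaceR μ θ = (laplace μ θ).toReal :=
  integral_eq_lintegral_of_nonneg_ae (Filter.Eventually.of_forall fun _ => (Real.exp_pos _).le)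
    (measurable_exp_tip θ).aestronglyMeasurable

theorem integrable_exp_mul_tip {θ : Mat r n} (h : θ ∈ interior {θ | laplace μ θ < ⊤})
    (a : Mat r n) : Integrable (fun x => Real.exp (-(tip θ x)) * tip a x) μ := by
  have hc : Continuous fun e : ℝ => θ + e • a := by fun_prop
  have hn : {θ | laplace μ θ < ⊤} ∈ nhds (θ + (0 : ℝ) • a) := by
    simpa using mem_interior_iff_mem_nhds.1 h
  obtain ⟨ε, hε, hball⟩ := Metric.eventually_nhds_iff.1 ((hc.tendsto 0).eventually hn)
  have hδ : 0 < ε / 2 := by positivity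
  have h1 := integrable_exp_of_laplace_lt_top (μ := μ) (hball (y := ε / 2) (by
    rw [Real.dist_eq, sub_zero, abs_of_pos hδ]; linarith))
  have h2 := integrable_exp_of_laplace_lt_top (μ := μ) (hball (y := -(ε / 2)) (by
    rw [Real.dist_eq, sub_zero, abs_neg, abs_of_pos hδ]; linarith))
  refine ((h1.add h2).const_mul (ε / 2)⁻¹).mono'
    ((measurable_exp_tip θ).mul (measurable_tip a)).aestronglyMeasurable
    (Filter.Eventually.of_forall fun x => ?_)
  have hy : ε / 2 * |tip a x| ≤ Real.exp (-(ε / 2 * tip a x)) + Real.exp (ε / 2 * tip a x) := by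
    have h3 : ε / 2 * |tip a x| = |ε / 2 * tip a x| := by rw [abs_mul, abs_of_pos hδ]
    rw [h3]
    have h4 := Real.add_one_le_exp (ε / 2 * tip a x)
    have h5 := Real.add_one_le_exp (-(ε / 2 * tip a x))
    have h6 := Real.exp_pos (ε / 2 * tip a x)
    have h7 := Real.exp_pos (-(ε / 2 * tip a x))
    rcases abs_cases (ε / 2 * tip a x) with ⟨h, _⟩ | ⟨h, _⟩ <;> rw [h] <;> linarith
  have h8 : Real.exp (-(tip (θ + (ε / 2) • a) x)) =
      Real.exp (-(tip θ x)) * Real.exp (-(ε / 2 * tip a x)) := by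
    rw [← Real.exp_add, tip_add_left, tip_smul_left]
    congr 1
    ring
  have h9 : Real.exp (-(tip (θ + (-(ε / 2)) • a) x)) =
      Real.exp (-(tip θ x)) * Real.exp (ε / 2 * tip a x) := by
    rw [← Real.exp_add, tip_add_left, tip_smul_left]
    congr 1
    ring
  rw [Real.norm_eq_abs, abs_mul, abs_of_pos (Real.exp_pos _), Pi.add_apply, h8, h9, ← mul_add,
    mul_left_comm]
  refine mul_le_mul_of_nonneg_left ?_ (Real.exp_pos _).le
  rwa [inv_mul_eq_div, le_div_iff₀ hδ, mul_comm]

theorem tip_single (p q : Idx r n) (x : Mat r n) : tip (Matrix.single p q 1) x = x q p := by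
  rw [tip, Matrix.trace_mul_comm, Matrix.trace_mul_single]
  simp

theorem integrable_exp_mul_entry {θ : Mat r n} (h : θ ∈ interior {θ | laplace μ θ < ⊤})
    (p q : Idx r n) : Integrable (fun x => Real.exp (-(tip θ x)) * x p q) μ := by
  simpa only [tip_single] using integrable_exp_mul_tip h (Matrix.single q p 1)

/-- Linear functionals commute with the mean. -/
theorem linear_meanMap {θ : Mat r n} (h : θ ∈ interior {θ | laplace μ θ < ⊤})
    (f : Mat r n →ₗ[ℝ] ℝ) :
    f (meanMap μ θ) = (laplaceR μ θ)⁻¹ * ∫ x, Real.exp (-(tip θ x)) * f x ∂μ := by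
  have hf : ∀ x : Mat r n, f x = ∑ p, ∑ q, x p q * f (Matrix.single p q 1) := fun x => by
    conv_lhs => rw [Matrix.matrix_eq_sum_single x]
    simp only [map_sum]
    refine Finset.sum_congr rfl fun p _ => Finset.sum_congr rfl fun q _ => ?_
    rw [← smul_eq_mul (x p q), ← map_smul, Matrix.smul_single, smul_eq_mul, mul_one]
  have hint : ∫ x, Real.exp (-(tip θ x)) * f x ∂μ =
      ∑ p, ∑ q, (∫ x, Real.exp (-(tip θ x)) * x p q ∂μ) * f (Matrix.single p q 1) := by
    have h1 : (fun x => Real.exp (-(tip θ x)) * f x) = fun x => ∑ p, ∑ q,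
        Real.exp (-(tip θ x)) * x p q * f (Matrix.single p q 1) := by
      funext x
      rw [hf x, Finset.mul_sum]
      refine Finset.sum_congr rfl fun p _ => ?_
      rw [Finset.mul_sum]
      exact Finset.sum_congr rfl fun q _ => by ring
    rw [h1, integral_finsetSum _ fun p _ => integrable_finsetSum _ fun q _ =>
      (integrable_exp_mul_entry h p q).mul_const _]
    refine Finset.sum_congr rfl fun p _ => ?_
    rw [integral_finsetSum _ fun q _ => (integrable_exp_mul_entry h p q).mul_const _]
    exact Finset.sum_congr rfl fun q _ => integral_mul_const _ _
  rw [hf, hint, Finset.mul_sum]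
  refine Finset.sum_congr rfl fun p _ => ?_
  rw [Finset.mul_sum]
  exact Finset.sum_congr rfl fun q _ => by rw [meanMap, Matrix.of_apply, mul_assoc]

theorem tip_meanMap {θ : Mat r n} (h : θ ∈ interior {θ | laplace μ θ < ⊤}) (a : Mat r n) :
    tip (meanMap μ θ) a = (laplaceR μ θ)⁻¹ * ∫ x, Real.exp (-(tip θ x)) * tip a x ∂μ := by
  rw [tip_comm]
  exact linear_meanMap h (IsLinearMap.mk' (tip a)
    ⟨fun x y => tip_add_right a x y, fun c x => tip_smul_right c a x⟩)

theorem meanMap_mem_Zspace (hsupp : μ (Zspace V)ᶜ = 0) {θ : Mat r n}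
    (h : θ ∈ interior {θ | laplace μ θ < ⊤}) : meanMap μ θ ∈ Zspace V := by
  by_contra hne
  obtain ⟨f, hf, hle⟩ := Submodule.exists_le_ker_of_notMem (p := zSub V) hne
  refine hf ?_
  rw [linear_meanMap h f, integral_eq_zero_of_ae, mul_zero]
  have hae : ∀ᵐ x ∂μ, x ∈ Zspace V := by
    rw [ae_iff]
    exact hsupp
  filter_upwards [hae] with x hx
  have : f x = 0 := hle hx
  simp [this]

/-- The tangent inequality for the Laplace transform. -/
theorem laplaceR_tangent_le {θ θ' : Mat r n} (h : θ ∈ interior {θ | laplace μ θ < ⊤})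
    (h0 : 0 < laplaceR μ θ) (h' : laplace μ θ' < ⊤) :
    laplaceR μ θ * (1 - tip (meanMap μ θ) (θ' - θ)) ≤ laplaceR μ θ' := by
  have hlt : θ ∈ {θ | laplace μ θ < ⊤} := interior_subset h
  have hi := integrable_exp_of_laplace_lt_top (μ := μ) (θ := θ) hlt
  have hi2 := integrable_exp_mul_tip h (θ' - θ)
  rw [tip_meanMap h, mul_sub, mul_one, mul_inv_cancel_left₀ h0.ne', laplaceR, laplaceR,
    ← integral_sub hi hi2]
  refine integral_mono (hi.sub hi2) (integrable_exp_of_laplace_lt_top h') fun x => ?_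
  have h1 : Real.exp (-(tip θ' x)) = Real.exp (-(tip θ x)) * Real.exp (-(tip (θ' - θ) x)) := by
    rw [← Real.exp_add, tip_sub_left]
    congr 1
    ring
  have h2 := Real.add_one_le_exp (-(tip (θ' - θ) x))
  have h3 := Real.exp_pos (-(tip θ x))
  beta_reduce
  rw [h1]
  nlinarith

theorem laplace_convex_le (θ θ' : Mat r n) {t : ℝ} (h0 : 0 ≤ t) (h1 : t ≤ 1) :
    laplace μ ((1 - t) • θ + t • θ') ≤ laplace μ θ + laplace μ θ' := by
  rw [laplace, laplace, laplace, ← lintegral_add_left (measurable_exp_tip θ).ennreal_ofReal]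
  refine lintegral_mono fun x => ?_
  rw [← ENNReal.ofReal_add (Real.exp_pos _).le (Real.exp_pos _).le]
  refine ENNReal.ofReal_le_ofReal ?_
  rw [tip_add_left, tip_smul_left, tip_smul_left]
  have h3 := Real.exp_pos (-(tip θ x))
  have h4 := Real.exp_pos (-(tip θ' x))
  rcases le_total (tip θ x) (tip θ' x) with h | h
  · have : Real.exp (-((1 - t) * tip θ x + t * tip θ' x)) ≤ Real.exp (-(tip θ x)) :=
      Real.exp_le_exp.2 (by nlinarith)
    linarith
  · have : Real.exp (-((1 - t) * tip θ x + t * tip θ' x)) ≤ Real.exp (-(tip θ' x)) :=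
      Real.exp_le_exp.2 (by nlinarith)
    linarith

end Laplace

section Domain

variable {V} {μ : Measure (Mat r n)} {s : Fin (r + 1) → ℝ}

theorem chi_neg {T : Mat r n} (hT : T ∈ Hgrp V) : chi (-s) T = (chi s T)⁻¹ := by
  have hp := (mem_Hgrp_iff.1 hT).2
  rw [chi_eq_exp_logChi _ hp, chi_eq_exp_logChi _ hp, logChi_neg, Real.exp_neg]

theorem laplaceR_mul_transpose
    (hL : ∀ T ∈ Hgrp V, laplace μ (T * Tᵀ) = ENNReal.ofReal (chi (-s) T)) {T : Mat r n}
    (hT : T ∈ Hgrp V) : laplaceR μ (T * Tᵀ) = Real.exp (-logChi s T) := by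
  rw [laplaceR_eq_toReal, hL T hT, ENNReal.toReal_ofReal (chi_pos _ hT).le,
    chi_eq_exp_logChi _ (mem_Hgrp_iff.1 hT).2, logChi_neg]

/-- The Laplace transform is infinite on `𝒵` outside `𝒫`. -/
theorem mem_Pcone_of_laplace_lt_top (hV1 : CondV1 V) (hV2 : CondV2 V) (hV3 : CondV3 V)
    (hs : ∀ k, 0 < s k)
    (hL : ∀ T ∈ Hgrp V, laplace μ (T * Tᵀ) = ENNReal.ofReal (chi (-s) T)) {θ : Mat r n}
    (hθ : θ ∈ Zspace V) (hfin : laplace μ θ < ⊤) : θ ∈ Pcone V := by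
  let f : ℝ → Mat r n := fun t => (1 - t) • 1 + t • θ
  have hf : Continuous f := by fun_prop
  have hfZ : ∀ t, f t ∈ Zspace V := fun t => mem_zSub.1 <|
    add_mem (Submodule.smul_mem _ _ (mem_zSub.2 one_mem_Zspace))
      (Submodule.smul_mem _ _ (mem_zSub.2 hθ))
  have hone : laplace μ (1 : Mat r n) < ⊤ := by
    have := hL 1 one_mem_Hgrp
    rw [Matrix.transpose_one, Matrix.mul_one] at this
    rw [this]
    exact ENNReal.ofReal_lt_top
  set C := (laplace μ (1 : Mat r n) + laplace μ θ).toReal with hC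
  have hCtop : laplace μ (1 : Mat r n) + laplace μ θ ≠ ⊤ := (ENNReal.add_lt_top.2 ⟨hone, hfin⟩).ne
  set R := (1 : Mat r n).trace + |θ.trace| + 1 with hR
  have htr1 : 0 ≤ (1 : Mat r n).trace := Matrix.PosSemidef.one.trace_nonneg
  have habs := abs_nonneg θ.trace
  let K : Set (Mat r n) := {T | ∀ p q, T p q ∈ Set.Icc (-R) R} ∩
    (hCl V ∩ {T | 1 ≤ C * chi s T})
  have hK : IsCompact K := (isCompact_box R).inter_right (isClosed_hCl.inter
    (isClosed_le continuous_const (continuous_const.mul (continuous_chi hs))))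
  have hKH : K ⊆ Hgrp V := fun T hT => by
    refine mem_Hgrp_of_chi_pos hs hT.2.1 ?_
    have h1 : 1 ≤ C * chi s T := hT.2.2
    exact pos_of_mul_pos_right (one_pos.trans_le h1) ENNReal.toReal_nonneg
  let Φ : Mat r n → Mat r n := fun T => T * Tᵀ
  have hΦ : Continuous Φ := continuous_id.matrix_mul continuous_id.matrix_transpose
  have hΦK : IsClosed (Φ '' K) := (hK.image hΦ).isClosed
  have hΦP : ∀ x ∈ Φ '' K, x ∈ Pcone V := by
    rintro _ ⟨T, hT, rfl⟩
    exact mul_transpose_self_mem_Pcone hV2 hV3 (hKH hT)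
  have hPΦ : ∀ t ∈ Set.Icc (0 : ℝ) 1, f t ∈ Pcone V → f t ∈ Φ '' K := by
    rintro t ⟨ht0, ht1⟩ hP
    obtain ⟨T, hT, hfT⟩ := exists_Hgrp_of_mem_Pcone hV1 hV2 hV3 hP
    refine ⟨T, ⟨abs_entry_le (by positivity) ?_, Hgrp_subset_hCl hT, ?_⟩, hfT.symm⟩
    · rw [nsq, ← hfT]
      have h1 : (f t).trace = (1 - t) * (1 : Mat r n).trace + t * θ.trace := by
        simp only [f, Matrix.trace_add, Matrix.trace_smul, smul_eq_mul]
      have h2 := le_abs_self θ.trace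
      rw [h1]
      nlinarith
    · have h1 := laplace_convex_le (μ := μ) 1 θ ht0 ht1
      have h2 := ENNReal.toReal_mono hCtop h1
      change (laplace μ (f t)).toReal ≤ C at h2
      rw [hfT, hL T hT, ENNReal.toReal_ofReal (chi_pos _ hT).le, chi_neg hT,
        inv_le_iff_one_le_mul₀ (chi_pos _ hT)] at h2
      exact h2
  have hsub : Set.Icc (0 : ℝ) 1 ⊆ f ⁻¹' (Φ '' K) := by
    refine IsClosed.Icc_subset_of_forall_exists_gt
      ((hΦK.preimage hf).inter isClosed_Icc) ?_ ?_
    · refine hPΦ 0 ⟨le_rfl, zero_le_one⟩ ⟨hfZ 0, ?_⟩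
      simpa [f] using Matrix.PosDef.one
    · rintro x ⟨hx, hx0, hx1⟩ y hy
      have hev := eventually_posDef hf (fun t => (hfZ t).1) (hΦP _ hx).2
      have hlt : x < min y 1 := lt_min hy hx1
      obtain ⟨t, ht, ht2⟩ := ((hev.filter_mono nhdsWithin_le_nhds).and
        (Ioc_mem_nhdsGT hlt)).exists
      exact ⟨t, hPΦ t ⟨hx0.trans ht2.1.le, ht2.2.trans (min_le_right _ _)⟩ ⟨hfZ t, ht⟩,
        ht2.1, ht2.2.trans (min_le_left _ _)⟩
  have h1 := hΦP _ (hsub ⟨zero_le_one, le_rfl⟩)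
  simpa [f] using h1

theorem laplace_congr (hsupp : μ (Zspace V)ᶜ = 0) {θ θ' : Mat r n}
    (h : ∀ z ∈ Zspace V, tip θ z = tip θ' z) : laplace μ θ = laplace μ θ' := by
  have hae : ∀ᵐ x ∂μ, x ∈ Zspace V := by
    rw [ae_iff]
    exact hsupp
  refine lintegral_congr_ae ?_
  filter_upwards [hae] with x hx
  rw [h x hx]

theorem Pcone_subset_interior (hV1 : CondV1 V) (hV2 : CondV2 V) (hV3 : CondV3 V)
    (hsupp : μ (Zspace V)ᶜ = 0)
    (hL : ∀ T ∈ Hgrp V, laplace μ (T * Tᵀ) = ENNReal.ofReal (chi (-s) T)) {θ : Mat r n}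
    (hθ : θ ∈ Pcone V) : θ ∈ interior {θ | laplace μ θ < ⊤} := by
  obtain ⟨π, hπ, hπZ⟩ := exists_projection V
  have h0 : π θ = θ := eq_of_tip_eq (hπZ θ).1 hθ.1 (hπZ θ).2
  rw [mem_interior_iff_mem_nhds]
  filter_upwards [eventually_posDef hπ (fun y => (hπZ y).1.1) (by rw [h0]; exact hθ.2)]
    with y hy
  obtain ⟨T, hT, hyT⟩ := exists_Hgrp_of_mem_Pcone hV1 hV2 hV3 ⟨(hπZ y).1, hy⟩
  have h1 : laplace μ y = ENNReal.ofReal (chi (-s) T) := by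
    rw [← hL T hT, ← hyT]
    exact laplace_congr hsupp fun z hz => ((hπZ y).2 z hz).symm
  have h2 : laplace μ y < ⊤ := by
    rw [h1]
    exact ENNReal.ofReal_lt_top
  exact h2

theorem stationary_meanMap (hV1 : CondV1 V) (hV2 : CondV2 V) (hV3 : CondV3 V)
    (hsupp : μ (Zspace V)ᶜ = 0)
    (hL : ∀ T ∈ Hgrp V, laplace μ (T * Tᵀ) = ENNReal.ofReal (chi (-s) T)) {T : Mat r n}
    (hT : T ∈ Hgrp V) : Stationary V s (meanMap μ (T * Tᵀ)) T := by
  refine stationary_of_forall_tangent hV1 hT fun W hW => ?_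
  have hint : T * Tᵀ ∈ interior {θ | laplace μ θ < ⊤} :=
    Pcone_subset_interior hV1 hV2 hV3 hsupp hL (mul_transpose_self_mem_Pcone hV2 hV3 hT)
  set m := meanMap μ (T * Tᵀ)
  have hE := Real.exp_pos (-logChi s T)
  have h1 := (hasDerivAt_logChi s hT W).fun_neg.exp.fun_add
    ((hasDerivAt_tip_quadratic m T W).const_mul (Real.exp (-logChi s T)))
  have h2 : IsLocalMin (fun e : ℝ => Real.exp (-logChi s (T + e • W)) +
      Real.exp (-logChi s T) * tip m ((T + e • W) * (T + e • W)ᵀ)) 0 := by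
    filter_upwards [eventually_add_smul_mem_Hgrp hT hW] with e he
    have h3 := laplaceR_tangent_le (μ := μ) (θ' := (T + e • W) * (T + e • W)ᵀ) hint
      (by rw [laplaceR_mul_transpose hL hT]; exact hE)
      (by rw [hL _ he]; exact ENNReal.ofReal_lt_top)
    rw [laplaceR_mul_transpose hL hT, laplaceR_mul_transpose hL he, tip_sub_right] at h3
    simp only [zero_smul, add_zero]
    linarith
  have h4 := h2.hasDerivAt_eq_zero h1
  simp only [zero_smul, add_zero] at h4
  have h5 : Real.exp (-logChi s T) * (tip m (W * Tᵀ + T * Wᵀ) -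
      ∑ k, 2 * s k * (tdiag W k / tdiag T k)) = 0 := by linarith
  exact sub_eq_zero.1 ((mul_eq_zero.1 h5).resolve_left hE.ne')

end Domain

section Means

variable {V} {s : Fin (r + 1) → ℝ}

theorem isClosed_posSemidef : IsClosed {x : Mat r n | x.PosSemidef} := by
  simp only [Matrix.posSemidef_iff_dotProduct_mulVec, Set.ofPred_and, Set.ofPred_forall]
  refine IsClosed.inter (isClosed_eq continuous_id.matrix_conjTranspose continuous_id)
    (isClosed_iInter fun v => isClosed_le continuous_const ?_)
  exact continuous_const.dotProduct (continuous_id.matrix_mulVec continuous_const)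

theorem closure_Pcone_subset : closure (Pcone V) ⊆ Zspace V ∩ {x | x.PosSemidef} :=
  closure_minimal (fun _ hx => ⟨hx.1, hx.2.posSemidef⟩)
    (isClosed_Zspace.inter isClosed_posSemidef)

theorem mem_Qcone_of_stationary (hV1 : CondV1 V) (hV2 : CondV2 V) (hV3 : CondV3 V)
    (hs : ∀ k, 0 < s k) {m T : Mat r n} (hT : T ∈ Hgrp V) (hm : m ∈ Zspace V)
    (h : Stationary V s m T) : m ∈ Qcone V := by
  refine ⟨hm, fun x hx hx0 => ?_⟩
  obtain ⟨hxZ, hxP⟩ := closure_Pcone_subset hx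
  obtain ⟨h1, h2⟩ := exists_eq_conj hV1 hV2 hV3 hT hxZ
  set a := T⁻¹ * x * T⁻¹ᵀ
  have haP : a.PosSemidef := by
    have := hxP.mul_mul_conjTranspose_same T⁻¹
    rwa [Matrix.conjTranspose_eq_transpose_of_trivial] at this
  have ha0 : a ≠ 0 := fun ha => hx0 (by rw [← h2, ha]; simp)
  obtain ⟨U, hU, hU2⟩ := exists_lowSub_add_transpose h1
  have hdiag : ∀ k, tdiag a k = 2 * tdiag U k := fun k => by
    rw [hU2, tdiag_add, tdiag_transpose]
    ring
  have hnn : ∀ k, 0 ≤ tdiag U k := fun k => by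
    have h3 : 0 ≤ tdiag a k := haP.diag_nonneg
    linarith [hdiag k]
  rw [← h2, hU2, h U hU]
  refine mul_pos two_pos (lt_of_le_of_ne
    (Finset.sum_nonneg fun k _ => mul_nonneg (hs k).le (hnn k)) fun h0 => ha0 ?_)
  rw [← haP.trace_eq_zero_iff, trace_eq_sum_tdiag (blk_diag_of_mem_Zspace h1)]
  refine Finset.sum_eq_zero fun k hk => ?_
  have h4 := (Finset.sum_eq_zero_iff_of_nonneg
    fun k _ => mul_nonneg (hs k).le (hnn k)).1 h0.symm k hk
  rw [hdiag, (mul_eq_zero.1 h4).resolve_left (hs k).ne']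
  simp

theorem mul_transpose_self_mem_closure (hV2 : CondV2 V) (hV3 : CondV3 V) {T : Mat r n}
    (hT : T ∈ lowSub V) : T * Tᵀ ∈ closure (Pcone V) := by
  have hc : Continuous fun e : ℝ => T * Tᵀ + e • (1 : Mat r n) := by fun_prop
  have hlim := (hc.tendsto 0).mono_left (nhdsWithin_le_nhds (s := Set.Ioi 0))
  rw [zero_smul, add_zero] at hlim
  refine mem_closure_of_tendsto hlim ?_
  filter_upwards [self_mem_nhdsWithin] with e he
  refine ⟨mem_zSub.1 (add_mem (mem_zSub.2 (mul_transpose_self_mem_Zspace hV2 hV3 hT))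
    (Submodule.smul_mem _ _ (mem_zSub.2 one_mem_Zspace))), ?_⟩
  refine Matrix.PosDef.posSemidef_add ?_ (Matrix.PosDef.one.smul he)
  have := Matrix.posSemidef_self_mul_conjTranspose T
  rwa [Matrix.conjTranspose_eq_transpose_of_trivial] at this

theorem continuous_tip_mul_transpose (m : Mat r n) :
    Continuous fun T : Mat r n => tip m (T * Tᵀ) :=
  continuous_tip continuous_const (continuous_id.matrix_mul continuous_id.matrix_transpose)

theorem exists_mul_nsq_le_of_mem_Qcone (hV2 : CondV2 V) (hV3 : CondV3 V) {m : Mat r n}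
    (hm : m ∈ Qcone V) : ∃ κ > 0, ∀ T ∈ lowSub V, κ * nsq T ≤ tip m (T * Tᵀ) := by
  refine exists_mul_nsq_le (continuous_tip_mul_transpose m) (fun c T => ?_)
    fun T hT h0 => hm.2 _ (mul_transpose_self_mem_closure hV2 hV3 hT) fun h => h0 ?_
  · rw [← tip_smul_right]
    congr 1
    simp [smul_smul, sq]
  · rw [← nsq_eq_zero_iff, nsq, h, Matrix.trace_zero]

end Means

section PowerFunction

variable {V} {s : Fin (r + 1) → ℝ}

/-- The diagonal matrix whose `k`-th block is `√(s_k / n_k) • 1`. -/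
noncomputable def sqrtDiag (n : Fin (r + 1) → ℕ+) (s : Fin (r + 1) → ℝ) : Mat r n :=
  Matrix.diagonal fun p => √(s p.1 / n p.1)

theorem tdiag_sqrtDiag (k : Fin (r + 1)) : tdiag (sqrtDiag n s) k = √(s k / n k) := by
  simp [tdiag, sqrtDiag]

theorem sqrtDiag_mem_Hgrp (hs : ∀ k, 0 < s k) : sqrtDiag n s ∈ Hgrp V := by
  have hp : ∀ k, 0 < s k / (n k : ℝ) := fun k =>
    div_pos (hs k) (by exact_mod_cast (n k).2)
  have hb : ∀ k l : Fin (r + 1), l ≠ k → blk (sqrtDiag n s) l k = 0 := fun k l h => by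
    ext a b
    simp [blk, sqrtDiag, h]
  refine ⟨fun k l h => hb k l h.ne, fun k l h => ?_, fun k => ⟨√(s k / n k),
    Real.sqrt_pos.2 (hp k), fun a b => ?_⟩⟩
  · rw [hb k l h.ne']
    exact zero_mem _
  · simp [sqrtDiag, Matrix.diagonal_apply]

/-- Value of the dual power function in terms of the stationary point. -/
theorem log_dual_power (hV1 : CondV1 V) (hV2 : CondV2 V) (hV3 : CondV3 V)
    (hs : ∀ k, 0 < s k) {rstar : Mat r n → Mat r n → Mat r n}
    (hrstar : ∀ T ∈ Hgrp V, ∀ ξ ∈ Zspace V, rstar T ξ ∈ Zspace V ∧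
      ∀ x ∈ Zspace V, tip (rstar T ξ) x = tip ξ (rhoM T x))
    {δ : Mat r n → ℝ} (hδ : ∀ T ∈ Hgrp V, δ (rstar T 1) = chi (-s) T)
    {m T : Mat r n} (hT : T ∈ Hgrp V) (hm : m ∈ Zspace V) (h : Stationary V s m T) :
    Real.log (δ m) = logChi s T + -logChi s (sqrtDiag n s) := by
  set C := sqrtDiag n s with hC
  have hCH : C ∈ Hgrp V := sqrtDiag_mem_Hgrp hs
  have hCl := (mem_Hgrp_iff.1 hCH).1
  have hCt : Cᵀ = C := Matrix.diagonal_transpose _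
  have hT' := inv_mem_Hgrp hV1 hT
  have hS : C * T⁻¹ ∈ Hgrp V := mul_mem_Hgrp hV1 hCH hT'
  have hST : C * T⁻¹ * T = C := by
    rw [Matrix.mul_assoc, Matrix.nonsing_inv_mul _ (isUnit_det_of_mem_Hgrp hT), Matrix.mul_one]
  obtain ⟨h1, h2⟩ := hrstar _ hS 1 one_mem_Zspace
  have hst : Stationary V s (rstar (C * T⁻¹) 1) T := by
    intro U hU
    have h3 : (C * T⁻¹) * (T * (U + Uᵀ) * Tᵀ) * (C * T⁻¹)ᵀ = C * U * C + (C * U * C)ᵀ := by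
      calc _ = (C * T⁻¹ * T) * (U + Uᵀ) * (C * T⁻¹ * T)ᵀ := by
            rw [Matrix.transpose_mul (C * T⁻¹) T]
            noncomm_ring
        _ = _ := by
            rw [hST, Matrix.transpose_mul, Matrix.transpose_mul, hCt]
            noncomm_ring
    rw [h2 _ (conj_mem_Zspace hV1 hV2 hV3 (mem_Hgrp_iff.1 hT).1
      (add_transpose_mem_Zspace hV2 hV3 hU)), rhoM, h3, tip_one_left, Matrix.trace_add,
      Matrix.trace_transpose, ← two_mul, trace_eq_sum_tdiag
        (blk_diag_of_mem_lowSub (mul_mem_lowSub hV1 (mul_mem_lowSub hV1 hCl hU) hCl))]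
    congr 1
    refine Finset.sum_congr rfl fun k _ => ?_
    rw [tdiag_mul (mul_mem_lowSub hV1 hCl hU) hCl, tdiag_mul hCl hU, hC, tdiag_sqrtDiag]
    have hn : (0 : ℝ) < n k := by exact_mod_cast (n k).2
    have hsq := Real.mul_self_sqrt (div_pos (hs k) hn).le
    calc (n k : ℝ) * (√(s k / n k) * tdiag U k * √(s k / n k))
        = n k * (√(s k / n k) * √(s k / n k)) * tdiag U k := by ring
      _ = s k * tdiag U k := by rw [hsq, mul_div_cancel₀ _ hn.ne']
  rw [Stationary.unique hV1 hV2 hV3 hT hm h1 h hst, hδ _ hS, log_chi _ hS, logChi_neg]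
  have h4 : logChi s C = logChi s (C * T⁻¹) + logChi s T := by
    rw [logChi, logChi, logChi, ← Finset.sum_add_distrib]
    refine Finset.sum_congr rfl fun k _ => ?_
    rw [← mul_add, ← Real.log_mul ((mem_Hgrp_iff.1 hS).2 k).ne' ((mem_Hgrp_iff.1 hT).2 k).ne',
      ← tdiag_mul (mem_Hgrp_iff.1 hS).1 (mem_Hgrp_iff.1 hT).1, hST]
  linarith

end PowerFunction

section Derivative

variable {V} {s : Fin (r + 1) → ℝ}

theorem abs_mul_transpose_self_apply_le (T : Mat r n) (p q : Idx r n) :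
    |(T * Tᵀ) p q| ≤ nsq T := by
  have hrow : ∀ p, ∑ k, T p k ^ 2 ≤ nsq T := fun p => by
    rw [nsq_eq_sum]
    exact Finset.single_le_sum (f := fun p => ∑ q, T p q ^ 2)
      (fun i _ => Finset.sum_nonneg fun j _ => sq_nonneg _) (Finset.mem_univ p)
  have h1 : |(T * Tᵀ) p q| ≤ ∑ k, (T p k ^ 2 + T q k ^ 2) / 2 := by
    rw [Matrix.mul_apply]
    refine (Finset.abs_sum_le_sum_abs _ _).trans (Finset.sum_le_sum fun k _ => ?_)
    rw [Matrix.transpose_apply, abs_mul]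
    nlinarith [sq_nonneg (|T p k| - |T q k|), sq_abs (T p k), sq_abs (T q k)]
  rw [← Finset.sum_div, Finset.sum_add_distrib] at h1
  linarith [hrow p, hrow q]

theorem abs_tip_mul_transpose_self_le (a T : Mat r n) :
    |tip a (T * Tᵀ)| ≤ (∑ p, ∑ q, |a p q|) * nsq T := by
  rw [tip_eq_sum, Finset.sum_mul]
  refine (Finset.abs_sum_le_sum_abs _ _).trans (Finset.sum_le_sum fun p _ => ?_)
  rw [Finset.sum_mul]
  refine (Finset.abs_sum_le_sum_abs _ _).trans (Finset.sum_le_sum fun q _ => ?_)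
  rw [abs_mul]
  exact mul_le_mul_of_nonneg_left (abs_mul_transpose_self_apply_le T q p) (abs_nonneg _)

theorem Stationary.tip_mul_transpose_self {m T : Mat r n} (h : Stationary V s m T) :
    tip m (T * Tᵀ) = ∑ k, s k := by
  have h1 := h ((1 / 2 : ℝ) • 1) (Submodule.smul_mem _ _ one_mem_lowSub)
  have h2 : ((1 / 2 : ℝ) • (1 : Mat r n)) + ((1 / 2 : ℝ) • (1 : Mat r n))ᵀ = 1 := by
    rw [Matrix.transpose_smul, Matrix.transpose_one, ← add_smul]
    norm_num
  rw [h2, Matrix.mul_one] at h1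
  rw [h1, Finset.mul_sum]
  refine Finset.sum_congr rfl fun k _ => ?_
  rw [tdiag_smul, tdiag_one]
  ring

/-- Stationarity is preserved under limits. -/
theorem stationary_of_tendsto {X : Type*} {l : Filter X} [l.NeBot] {M T : X → Mat r n}
    {m T' : Mat r n} (hM : Filter.Tendsto M l (nhds m)) (hT : Filter.Tendsto T l (nhds T'))
    (h : ∀ᶠ x in l, Stationary V s (M x) (T x)) : Stationary V s m T' := by
  intro U hU
  have hc : Continuous fun z : Mat r n × Mat r n => tip z.1 (z.2 * (U + Uᵀ) * z.2ᵀ) :=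
    continuous_tip continuous_fst ((continuous_snd.matrix_mul continuous_const).matrix_mul
      continuous_snd.matrix_transpose)
  have h1 := (hc.tendsto (m, T')).comp (hM.prodMk_nhds hT)
  refine tendsto_nhds_unique h1 (tendsto_const_nhds.congr' ?_)
  filter_upwards [h] with x hx
  exact (hx U hU).symm

/-- A function squeezed between two affine-like bounds whose slopes converge is
differentiable. -/
theorem hasDerivAt_of_slope_bounds {F g : ℝ → ℝ} {d : ℝ}
    (hg : Filter.Tendsto g (nhds 0) (nhds d))
    (hlow : ∀ᶠ t in nhds 0, t * d ≤ F t - F 0)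
    (hup : ∀ᶠ t in nhds 0, F t - F 0 ≤ t * g t) : HasDerivAt F d 0 := by
  rw [hasDerivAt_iff_isLittleO_nhds_zero, Asymptotics.isLittleO_iff]
  intro c hc
  filter_upwards [hlow, hup, Metric.tendsto_nhds.1 hg c hc] with t h1 h2 h3
  rw [Real.dist_eq] at h3
  rw [zero_add, smul_eq_mul, Real.norm_eq_abs, Real.norm_eq_abs,
    abs_of_nonneg (by linarith)]
  calc F t - F 0 - t * d ≤ t * (g t - d) := by linarith
    _ ≤ |t| * |g t - d| := by rw [← abs_mul]; exact le_abs_self _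
    _ ≤ c * |t| := by rw [mul_comm]; gcongr

theorem hasDerivAt_of_stationary (hV1 : CondV1 V) (hV2 : CondV2 V) (hV3 : CondV3 V)
    (hs : ∀ k, 0 < s k) {m a θ : Mat r n} (hm : m ∈ Qcone V)
    (huniq : ∀ T ∈ Hgrp V, Stationary V s m T → T * Tᵀ = θ) {F : ℝ → ℝ} {c : ℝ}
    (hF : ∀ t, ∀ T ∈ Hgrp V, Stationary V s (m + t • a) T → F t = logChi s T + c) :
    HasDerivAt F (-(tip θ a)) 0 := by
  obtain ⟨κ, hκ, hκm⟩ := exists_mul_nsq_le_of_mem_Qcone hV2 hV3 hm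
  set A := ∑ p, ∑ q, |a p q|
  have hA : 0 ≤ A := by positivity
  set ε := κ / (2 * (A + 1)) with hε
  have hε0 : 0 < ε := by positivity
  have hεA : ε * A ≤ κ / 2 := by
    rw [hε, div_mul_eq_mul_div, div_le_div_iff₀ (by positivity) two_pos]
    nlinarith
  have hcoer : ∀ t, |t| ≤ ε → ∀ T ∈ lowSub V, κ / 2 * nsq T ≤ tip (m + t • a) (T * Tᵀ) := by
    intro t ht T hT
    rw [tip_add_left, tip_smul_left]
    have h1 := hκm T hT
    have h2 : |t * tip a (T * Tᵀ)| ≤ κ / 2 * nsq T := by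
      rw [abs_mul]
      calc |t| * |tip a (T * Tᵀ)| ≤ ε * (A * nsq T) :=
            mul_le_mul ht (abs_tip_mul_transpose_self_le a T) (abs_nonneg _) hε0.le
        _ = ε * A * nsq T := by ring
        _ ≤ κ / 2 * nsq T := mul_le_mul_of_nonneg_right hεA (nsq_nonneg T)
    linarith [neg_abs_le (t * tip a (T * Tᵀ))]
  have hex : ∀ t, ∃ T, |t| ≤ ε → T ∈ Hgrp V ∧ ∀ S ∈ Hgrp V,
      logChi s S - tip (m + t • a) (S * Sᵀ) ≤ logChi s T - tip (m + t • a) (T * Tᵀ) := by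
    intro t
    by_cases ht : |t| ≤ ε
    · obtain ⟨T, hT, hmax⟩ := exists_maximizer hs (continuous_tip_mul_transpose (m + t • a))
        (half_pos hκ) (hcoer t ht)
      exact ⟨T, fun _ => ⟨hT, hmax⟩⟩
    · exact ⟨0, fun h => absurd h ht⟩
  choose T hT using hex
  have hH : ∀ t, |t| ≤ ε → T t ∈ Hgrp V := fun t ht => (hT t ht).1
  have hst : ∀ t, |t| ≤ ε → Stationary V s (m + t • a) (T t) := fun t ht =>
    stationary_of_maximizer hV1 (hH t ht) (hT t ht).2
  have hle0 : |(0 : ℝ)| ≤ ε := by simpa using hε0.le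
  have hθ0 : T 0 * (T 0)ᵀ = θ := huniq _ (hH 0 hle0) (by simpa using hst 0 hle0)
  have hFt : ∀ t, |t| ≤ ε → F t = logChi s (T t) + c := fun t ht =>
    hF t _ (hH t ht) (hst t ht)
  have hlow : ∀ t, |t| ≤ ε → t * -(tip θ a) ≤ F t - F 0 := fun t ht => by
    have h1 := (hT t ht).2 _ (hH 0 hle0)
    have h2 := (hst 0 hle0).tip_mul_transpose_self
    rw [(hst t ht).tip_mul_transpose_self, hθ0, tip_add_left, tip_smul_left] at h1
    rw [hθ0, zero_smul, add_zero] at h2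
    rw [hFt t ht, hFt 0 hle0, tip_comm θ a]
    linarith
  have hup : ∀ t, |t| ≤ ε → F t - F 0 ≤ t * -(tip (T t * (T t)ᵀ) a) := fun t ht => by
    have h1 := (hT 0 hle0).2 _ (hH t ht)
    have h2 := (hst t ht).tip_mul_transpose_self
    rw [(hst 0 hle0).tip_mul_transpose_self, zero_smul, add_zero] at h1
    rw [tip_add_left, tip_smul_left] at h2
    rw [hFt t ht, hFt 0 hle0, tip_comm _ a]
    linarith
  have hev : ∀ᶠ t : ℝ in nhds 0, |t| ≤ ε := by
    filter_upwards [Metric.closedBall_mem_nhds (0 : ℝ) hε0] with t ht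
    simpa using ht
  set R := (∑ k, s k) / (κ / 2) + 1
  have hσ : 0 ≤ (∑ k, s k) / (κ / 2) :=
    div_nonneg (Finset.sum_nonneg fun k _ => (hs k).le) (half_pos hκ).le
  set B := logChi s (T 0) - ε * |tip θ a|
  let K : Set (Mat r n) := {T | ∀ p q, T p q ∈ Set.Icc (-R) R} ∩
    (hCl V ∩ {T | Real.exp B ≤ chi s T})
  have hK : IsCompact K := (isCompact_box R).inter_right (isClosed_hCl.inter
    (isClosed_le continuous_const (continuous_chi hs)))
  have hTK : ∀ t, |t| ≤ ε → T t ∈ K := by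
    intro t ht
    refine ⟨abs_entry_le (by positivity) ?_, Hgrp_subset_hCl (hH t ht), ?_⟩
    · have h1 := hcoer t ht _ (mem_Hgrp_iff.1 (hH t ht)).1
      rw [(hst t ht).tip_mul_transpose_self, mul_comm, ← le_div_iff₀ (half_pos hκ)] at h1
      refine h1.trans ?_
      simp only [R]
      nlinarith
    · change Real.exp B ≤ chi s (T t)
      rw [chi_eq_exp_logChi _ (mem_Hgrp_iff.1 (hH t ht)).2, Real.exp_le_exp]
      have h1 := hlow t ht
      rw [hFt t ht, hFt 0 hle0] at h1
      have h2 : |t * tip θ a| ≤ ε * |tip θ a| := by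
        rw [abs_mul]
        gcongr
      have h3 := le_abs_self (t * tip θ a)
      simp only [B]
      linarith
  have hlim : Filter.Tendsto (fun t => T t * (T t)ᵀ) (nhds 0) (nhds θ) := by
    rw [Filter.tendsto_iff_ultrafilter]
    intro g hg
    have hevg : ∀ᶠ t in (g : Filter ℝ), |t| ≤ ε := hg hev
    obtain ⟨T', hT'K, hT'⟩ := hK.ultrafilter_le_nhds (g.map T)
      (Filter.le_principal_iff.2 (hevg.mono hTK))
    have hTT' : Filter.Tendsto T g (nhds T') := hT'
    have hT'H : T' ∈ Hgrp V :=
      mem_Hgrp_of_chi_pos hs hT'K.2.1 ((Real.exp_pos B).trans_le hT'K.2.2)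
    have hc : Continuous fun t : ℝ => m + t • a := by fun_prop
    have hM := (hc.tendsto 0).mono_left hg
    rw [zero_smul, add_zero] at hM
    have hθ' := huniq T' hT'H (stationary_of_tendsto hM hTT' (hevg.mono hst))
    have hΦ : Continuous fun T : Mat r n => T * Tᵀ :=
      continuous_id.matrix_mul continuous_id.matrix_transpose
    rw [← hθ']
    exact (hΦ.tendsto T').comp hTT'
  have htip : Continuous fun x : Mat r n => -(tip x a) :=
    (continuous_tip continuous_id continuous_const).neg
  exact hasDerivAt_of_slope_bounds ((htip.tendsto θ).comp hlim) (hev.mono hlow) (hev.mono hup)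

end Derivative

/-- Let `s ∈ 𝔛` with all `s_k > 0` and let `R*_s` be the Riesz measure on
`𝒵` with Laplace transform `Δ_{-s}` on `𝒫`.  Then `Θ(R*_s) = 𝒫`, the domain of means
`M_{F(R*_s)}` equals `𝒬`, and the inverse `ψ_s` of the mean map satisfies
`ψ_s(m) = -(log δ_{-s})'(m)` for every `m ∈ 𝒬` (gradient with respect to the trace inner
product, expressed through directional derivatives along `𝒵`). -/
theorem statement7 (r : ℕ) (n : Fin (r + 1) → ℕ+)
    (V : ∀ l k : Fin (r + 1), Submodule ℝ (Matrix (Fin (n l)) (Fin (n k)) ℝ))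
    (hV1 : CondV1 V) (hV2 : CondV2 V) (hV3 : CondV3 V)
    (rstar : Mat r n → Mat r n → Mat r n)
    (hrstar : ∀ T ∈ Hgrp V, ∀ ξ ∈ Zspace V, rstar T ξ ∈ Zspace V ∧
      ∀ x ∈ Zspace V, tip (rstar T ξ) x = tip ξ (rhoM T x))
    (Δf : (Fin (r + 1) → ℝ) → Mat r n → ℝ)
    (hΔ : ∀ s : Fin (r + 1) → ℝ, ∀ T ∈ Hgrp V, Δf s (rhoM T 1) = chi s T)
    (δf : (Fin (r + 1) → ℝ) → Mat r n → ℝ)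
    (hδ : ∀ s : Fin (r + 1) → ℝ, ∀ T ∈ Hgrp V, δf s (rstar T 1) = chi s T)
    (s : Fin (r + 1) → ℝ) (hs : s ∈ frakX V) (hspos : ∀ k, 0 < s k)
    (μ : Measure (Mat r n)) (hμsupp : μ (Zspace V)ᶜ = 0)
    (hμL : ∀ θ ∈ Pcone V, laplace μ θ = ENNReal.ofReal (Δf (-s) θ))
    (Θs : Set (Mat r n))
    (hΘs : Θs = interior {θ | laplace μ θ < ⊤} ∩ Zspace V)
    (ψ : Mat r n → Mat r n)
    (hψ : Set.InvOn ψ (meanMap μ) Θs (meanMap μ '' Θs)) :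
    Θs = Pcone V ∧
    meanMap μ '' Θs = Qcone V ∧
    ∀ m ∈ Qcone V, ∀ a ∈ Zspace V,
      HasDerivAt (fun t : ℝ => Real.log (δf (-s) (m + t • a))) (-(tip (ψ m) a)) 0 := by
  have hL : ∀ T ∈ Hgrp V, laplace μ (T * Tᵀ) = ENNReal.ofReal (chi (-s) T) := fun T hT => by
    rw [hμL _ (mul_transpose_self_mem_Pcone hV2 hV3 hT), ← hΔ _ T hT, rhoM, Matrix.mul_one]
  have hint : ∀ θ ∈ Pcone V, θ ∈ interior {θ | laplace μ θ < ⊤} := fun θ hθ =>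
    Pcone_subset_interior hV1 hV2 hV3 hμsupp hL hθ
  have hΘ : Θs = Pcone V := by
    rw [hΘs]
    refine Set.Subset.antisymm (fun θ hθ => ?_) fun θ hθ => ⟨hint θ hθ, hθ.1⟩
    exact mem_Pcone_of_laplace_lt_top hV1 hV2 hV3 hspos hL hθ.2
      (interior_subset (s := {θ | laplace μ θ < ⊤}) hθ.1)
  have hmean : ∀ T ∈ Hgrp V, ∀ m ∈ Zspace V, Stationary V s m T →
      meanMap μ (T * Tᵀ) = m := fun T hT m hm h =>
    Stationary.unique hV1 hV2 hV3 hT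
      (meanMap_mem_Zspace hμsupp (hint _ (mul_transpose_self_mem_Pcone hV2 hV3 hT))) hm
      (stationary_meanMap hV1 hV2 hV3 hμsupp hL hT) h
  have hpre : ∀ m ∈ Zspace V, ∀ T ∈ Hgrp V, Stationary V s m T → T * Tᵀ = ψ m :=
    fun m hm T hT h => by
      have h1 := hψ.1 (x := T * Tᵀ) (by
        rw [hΘ]
        exact mul_transpose_self_mem_Pcone hV2 hV3 hT)
      rw [← h1, hmean T hT m hm h]
  refine ⟨hΘ, ?_, fun m hm a ha => ?_⟩
  · rw [hΘ]
    refine Set.Subset.antisymm ?_ fun ξ hξ => ?_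
    · rintro _ ⟨θ, hθ, rfl⟩
      obtain ⟨T, hT, rfl⟩ := exists_Hgrp_of_mem_Pcone hV1 hV2 hV3 hθ
      exact mem_Qcone_of_stationary hV1 hV2 hV3 hspos hT
        (meanMap_mem_Zspace hμsupp (hint _ hθ))
        (stationary_meanMap hV1 hV2 hV3 hμsupp hL hT)
    · obtain ⟨κ, hκ, hκξ⟩ := exists_mul_nsq_le_of_mem_Qcone hV2 hV3 hξ
      obtain ⟨T, hT, hmax⟩ := exists_maximizer hspos (continuous_tip_mul_transpose ξ) hκ hκξ
      exact ⟨T * Tᵀ, mul_transpose_self_mem_Pcone hV2 hV3 hT,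
        hmean T hT ξ hξ.1 (stationary_of_maximizer hV1 hT hmax)⟩
  · refine hasDerivAt_of_stationary hV1 hV2 hV3 hspos hm (hpre m hm.1)
      (c := -logChi s (sqrtDiag n s)) fun t T hT h => ?_
    exact log_dual_power hV1 hV2 hV3 hspos hrstar (hδ (-s)) hT
      (mem_zSub.1 (add_mem (mem_zSub.2 hm.1) (Submodule.smul_mem _ _ (mem_zSub.2 ha)))) h

end Wishart
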